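/- arXiv:1610.03448 — 3 statements merged into one kernel-verified Lean document; each statement's English description precedes it below -/
import Mathlib

section
/- Let Γ ⊂ ℝ^{n+1} be a closed set contained in the cylinder {|x|<1}, with Γ ⊂ {x_{n+1} ≥ 0}, and suppose Γ ∩ (B_{1/2}(0) × [0,θ]) ≠ ∅ for some θ > 0. For every μ > 0 small there exists M > 0 depending only on μ, n and Λ such that if Γ satisfies property (P) with constant Λ and interval I = [θ, Mθ], then |B_{1/2}(0) ∖ D_{Mθ}| ≤ μ |B_{1/2}(0)|. -/
open MeasureTheory Metric Set

noncomputable section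

/-- The paraboloid `P_{a,Y}(x) = -(a/2)|x-y|² + y_{n+1}` of opening `-a`, vertex
`Y = (y, y_{n+1})` and center `y`. -/
def parab (n : ℕ) (a : ℝ) (Y : EuclideanSpace ℝ (Fin n) × ℝ)
    (x : EuclideanSpace ℝ (Fin n)) : ℝ :=
  -(a/2) * ‖x - Y.1‖^2 + Y.2

/-- The graph of `P_{a,Y}` is tangent by below to `Γ` at `Z`. -/
def TangentBelow (n : ℕ) (Γ : Set (EuclideanSpace ℝ (Fin n) × ℝ)) (a : ℝ)
    (Y Z : EuclideanSpace ℝ (Fin n) × ℝ) : Prop :=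
  Z ∈ Γ ∧ Z.2 = parab n a Y Z.1 ∧ ∀ X ∈ Γ, parab n a Y X.1 ≤ X.2

/-- Property (P): near any contact point `Z` (with `|z| ≤ 3/4`) of a tangent-by-below
paraboloid of opening `-a`, `a ∈ I`, centered at some `|y| ≤ 1`, the set `Γ` is the graph of a
`C²` function `v` with `‖D²v(z)‖ ≤ Λ a`. -/
def PropertyP (n : ℕ) (Γ : Set (EuclideanSpace ℝ (Fin n) × ℝ)) (Λ : ℝ) (I : Set ℝ) : Prop :=
  ∀ a ∈ I, ∀ Y Z : EuclideanSpace ℝ (Fin n) × ℝ, ‖Y.1‖ ≤ 1 → ‖Z.1‖ ≤ 3/4 →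
    TangentBelow n Γ a Y Z →
    ∃ r : ℝ, 0 < r ∧ ∃ v : EuclideanSpace ℝ (Fin n) → ℝ, ContDiff ℝ 2 v ∧
      ‖iteratedFDeriv ℝ 2 v Z.1‖ ≤ Λ * a ∧
      Γ ∩ Metric.ball Z r =
        {X : EuclideanSpace ℝ (Fin n) × ℝ | X.2 = v X.1} ∩ Metric.ball Z r

/-- The set `𝒟_a` of contact points appearing in property (P). -/
def contactSet (n : ℕ) (Γ : Set (EuclideanSpace ℝ (Fin n) × ℝ)) (a : ℝ) :
    Set (EuclideanSpace ℝ (Fin n) × ℝ) :=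
  {Z | ‖Z.1‖ ≤ 3/4 ∧ ∃ Y : EuclideanSpace ℝ (Fin n) × ℝ, ‖Y.1‖ ≤ 1 ∧ TangentBelow n Γ a Y Z}

/-- `D_a`: the projection of `𝒟_a` along `e_{n+1}` onto `ℝⁿ`. -/
def contactProj (n : ℕ) (Γ : Set (EuclideanSpace ℝ (Fin n) × ℝ)) (a : ℝ) :
    Set (EuclideanSpace ℝ (Fin n)) :=
  Prod.fst '' contactSet n Γ a

/-- Completing the square: the sum of two concave paraboloids is a concave paraboloid whose center
is the corresponding weighted mean. -/
lemma mul_sq_add_mul_sq_eq {V : Type*} [NormedAddCommGroup V] [InnerProductSpace ℝ V]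
    {a K : ℝ} (haK : a + K ≠ 0) (x y₀ y : V) :
    a * ‖x - y₀‖ ^ 2 + K * ‖x - y‖ ^ 2 =
      (a + K) * ‖x - (a + K)⁻¹ • (a • y₀ + K • y)‖ ^ 2 + a * K / (a + K) * ‖y₀ - y‖ ^ 2 := by
  have h1 : x - (a + K)⁻¹ • (a • y₀ + K • y) =
      (a + K)⁻¹ • (a • (x - y₀) + K • (x - y)) := by
    have : x = (a + K)⁻¹ • ((a + K) • x) := by rw [smul_smul, inv_mul_cancel₀ haK, one_smul]
    nth_rewrite 1 [this]
    rw [← smul_sub]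
    congr 1
    module
  have h2 : y₀ - y = (x - y) - (x - y₀) := by abel
  rw [h1, h2, norm_sub_sq_real (x - y), norm_smul, mul_pow, norm_add_sq_real, norm_smul, norm_smul,
    real_inner_smul_left, real_inner_smul_right, mul_pow, mul_pow, Real.norm_eq_abs,
    Real.norm_eq_abs, Real.norm_eq_abs, sq_abs, sq_abs, sq_abs, real_inner_comm (x - y₀)]
  field_simp
  ring

/-- A weighted mean of two points of the closed unit ball stays in it. -/
lemma norm_weighted_mean_le_one {V : Type*} [NormedAddCommGroup V] [NormedSpace ℝ V]
    {a K : ℝ} (ha : 0 < a) (hK : 0 ≤ K) {y₀ y : V} (hy₀ : ‖y₀‖ ≤ 1) (hy : ‖y‖ ≤ 1) :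
    ‖(a + K)⁻¹ • (a • y₀ + K • y)‖ ≤ 1 := by
  have haK : 0 < a + K := by linarith
  rw [norm_smul, norm_inv, Real.norm_of_nonneg haK.le, inv_mul_le_iff₀ haK, mul_one]
  calc ‖a • y₀ + K • y‖ ≤ ‖a • y₀‖ + ‖K • y‖ := norm_add_le _ _
    _ = a * ‖y₀‖ + K * ‖y‖ := by
        rw [norm_smul, norm_smul, Real.norm_of_nonneg ha.le, Real.norm_of_nonneg hK]
    _ ≤ a + K := by nlinarith

/-- The determinant of an operator is at most its norm to the power of the dimension. -/
lemma abs_det_le_pow {V : Type*} [NormedAddCommGroup V] [InnerProductSpace ℝ V]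
    [FiniteDimensional ℝ V] [MeasurableSpace V] [BorelSpace V] (A : V →L[ℝ] V) {L : ℝ}
    (hA : ‖A‖ ≤ L) : |A.det| ≤ L ^ Module.finrank ℝ V := by
  have hL : 0 ≤ L := (norm_nonneg A).trans hA
  have h1 := Measure.addHaar_image_continuousLinearMap (volume : Measure V) A (closedBall 0 1)
  have h2 : A '' closedBall 0 1 ⊆ closedBall 0 L := by
    rintro _ ⟨x, hx, rfl⟩
    rw [mem_closedBall_zero_iff] at hx ⊢
    calc ‖A x‖ ≤ ‖A‖ * ‖x‖ := A.le_opNorm x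
      _ ≤ L * 1 := by gcongr
      _ = L := mul_one L
  have h3 := measure_mono (μ := (volume : Measure V)) h2
  rw [h1, Measure.addHaar_closedBall _ _ hL, Measure.addHaar_closedBall _ _ zero_le_one,
    one_pow, ENNReal.ofReal_one, one_mul] at h3
  have h4 := (ENNReal.mul_le_mul_iff_left (measure_ball_pos volume (0 : V) one_pos).ne'
    measure_ball_lt_top.ne).1 h3
  exact (ENNReal.ofReal_le_ofReal_iff (by positivity)).1 h4

/-- Second order necessary condition for a local minimum of a function of one variable. -/
lemma IsLocalMin.second_deriv_nonneg {f f' : ℝ → ℝ} {x c : ℝ} (hmin : IsLocalMin f x)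
    (hf : ∀ᶠ t in nhds x, HasDerivAt f (f' t) t) (hf' : HasDerivAt f' c x) : 0 ≤ c := by
  by_contra! hc
  have h1 : deriv f =ᶠ[nhds x] f' := hf.mono fun t ht => ht.deriv
  have h2 : deriv (deriv f) x = c := by rw [h1.deriv_eq, hf'.deriv]
  have hmax := isLocalMax_of_deriv_deriv_neg (h2 ▸ hc) hmin.deriv_eq_zero
    hf.self_of_nhds.continuousAt
  have h3 : f =ᶠ[nhds x] fun _ => f x := by
    filter_upwards [hmin, hmax] with t h h' using le_antisymm h' h
  have h4 : deriv f =ᶠ[nhds x] fun _ => 0 := by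
    filter_upwards [h3.eventuallyEq_nhds] with t ht
    rw [ht.deriv_eq, deriv_const]
  rw [h4.deriv_eq, deriv_const] at h2
  exact hc.ne h2.symm

section ContactSets

variable {n : ℕ} {Γ : Set (EuclideanSpace ℝ (Fin n) × ℝ)}

/-- A continuous function of the base point, subtracted from the height, attains its minimum. -/
lemma exists_min_height_sub (hΓ : IsClosed Γ) (hcyl : ∀ X ∈ Γ, ‖X.1‖ < 1)
    (hpos : ∀ X ∈ Γ, 0 ≤ X.2) (hne : Γ.Nonempty) {ψ : EuclideanSpace ℝ (Fin n) → ℝ}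
    (hψ : Continuous ψ) : ∃ Z ∈ Γ, ∀ X ∈ Γ, Z.2 - ψ Z.1 ≤ X.2 - ψ X.1 := by
  obtain ⟨X₀, hX₀⟩ := hne
  obtain ⟨m, hm⟩ := (isCompact_closedBall (0 : EuclideanSpace ℝ (Fin n)) 1).bddAbove_image
    hψ.continuousOn
  have hm' : ∀ X ∈ Γ, ψ X.1 ≤ m := fun X hX =>
    hm ⟨X.1, mem_closedBall_zero_iff.2 (hcyl X hX).le, rfl⟩
  set H := X₀.2 - ψ X₀.1 + m
  have hK : IsCompact (Γ ∩ (closedBall (0 : EuclideanSpace ℝ (Fin n)) 1 ×ˢ Icc 0 H)) :=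
    ((isCompact_closedBall _ _).prod isCompact_Icc).inter_left hΓ
  have hmem : ∀ X ∈ Γ, X.2 ≤ H →
      X ∈ Γ ∩ (closedBall (0 : EuclideanSpace ℝ (Fin n)) 1 ×ˢ Icc 0 H) := fun X hX h =>
    ⟨hX, mem_closedBall_zero_iff.2 (hcyl X hX).le, hpos X hX, h⟩
  have hX₀K := hmem X₀ hX₀ (by have := hm' X₀ hX₀; simp only [H]; linarith)
  obtain ⟨Z, hZ, hmin⟩ := hK.exists_isMinOn ⟨X₀, hX₀K⟩
    (f := fun X => X.2 - ψ X.1) (by fun_prop)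
  refine ⟨Z, hZ.1, fun X hX => ?_⟩
  by_cases h : X.2 ≤ H
  · exact hmin (hmem X hX h)
  · have h1 : Z.2 - ψ Z.1 ≤ X₀.2 - ψ X₀.1 := hmin hX₀K
    have h2 := hm' X hX
    simp only [H, not_le] at h
    linarith

/-- Sliding a paraboloid vertically until it touches. -/
lemma exists_tangentBelow (hΓ : IsClosed Γ) (hcyl : ∀ X ∈ Γ, ‖X.1‖ < 1)
    (hpos : ∀ X ∈ Γ, 0 ≤ X.2) (hne : Γ.Nonempty) (a : ℝ) (y : EuclideanSpace ℝ (Fin n)) :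
    ∃ h Z, TangentBelow n Γ a (y, h) Z := by
  obtain ⟨Z, hZ, hmin⟩ := exists_min_height_sub hΓ hcyl hpos hne
    (ψ := fun x => -(a / 2) * ‖x - y‖ ^ 2) (by fun_prop)
  refine ⟨Z.2 + (a / 2) * ‖Z.1 - y‖ ^ 2, Z, hZ, by simp [parab], fun X hX => ?_⟩
  have := hmin X hX
  simp only [parab] at this ⊢
  linarith

/-- At a contact point a smaller paraboloid with larger opening touches too. -/
lemma TangentBelow.add {a K : ℝ} (haK : a + K ≠ 0) {Y Z : EuclideanSpace ℝ (Fin n) × ℝ}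
    {y : EuclideanSpace ℝ (Fin n)} (hZ : Z ∈ Γ)
    (h : ∀ X ∈ Γ, Z.2 - parab n a Y Z.1 + K / 2 * ‖Z.1 - y‖ ^ 2 ≤
      X.2 - parab n a Y X.1 + K / 2 * ‖X.1 - y‖ ^ 2) :
    ∃ k, TangentBelow n Γ (a + K) ((a + K)⁻¹ • (a • Y.1 + K • y), k) Z := by
  refine ⟨_, hZ, (add_sub_cancel (-((a + K) / 2) *
    ‖Z.1 - (a + K)⁻¹ • (a • Y.1 + K • y)‖ ^ 2) Z.2).symm, fun X hX => ?_⟩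
  have h1 := h X hX
  have h2 := mul_sq_add_mul_sq_eq haK X.1 Y.1 y
  have h3 := mul_sq_add_mul_sq_eq haK Z.1 Y.1 y
  simp only [parab] at h1 ⊢
  linarith

lemma contactProj_mono {a b : ℝ} (ha : 0 < a) (hab : a ≤ b) :
    contactProj n Γ a ⊆ contactProj n Γ b := by
  obtain ⟨K, hK, rfl⟩ : ∃ K : ℝ, 0 ≤ K ∧ b = a + K := ⟨b - a, by linarith, by ring⟩
  intro z hz
  obtain ⟨Z, ⟨hZ, Y, hY, hT⟩, hz⟩ := hz
  have h0 : ∀ X ∈ Γ, Z.2 - parab n a Y Z.1 + K / 2 * ‖Z.1 - Z.1‖ ^ 2 ≤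
      X.2 - parab n a Y X.1 + K / 2 * ‖X.1 - Z.1‖ ^ 2 := fun X hX => by
    have h1 := hT.2.1
    have h2 := hT.2.2 X hX
    have h3 : 0 ≤ K / 2 * ‖X.1 - Z.1‖ ^ 2 := by positivity
    simp only [sub_self, norm_zero]
    linarith
  have haK : a + K ≠ 0 := by positivity
  obtain ⟨k, hk⟩ := TangentBelow.add haK hT.1 h0
  exact ⟨Z, ⟨hZ, (_, k), norm_weighted_mean_le_one ha hK hY (hZ.trans (by norm_num)), hk⟩, hz⟩

/-- A paraboloid centered in the unit ball has slope at most `2a` there. -/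
lemma parab_sub_parab_le {a : ℝ} (ha : 0 ≤ a) (Y : EuclideanSpace ℝ (Fin n) × ℝ)
    (hY : ‖Y.1‖ ≤ 1) {x x' : EuclideanSpace ℝ (Fin n)} (hx : ‖x‖ ≤ 1) (hx' : ‖x'‖ ≤ 1) :
    parab n a Y x - parab n a Y x' ≤ 2 * a * ‖x - x'‖ := by
  have h1 : ‖x' - Y.1‖ ≤ ‖x - Y.1‖ + ‖x - x'‖ := by
    have := norm_sub_le_norm_sub_add_norm_sub x' x Y.1
    rw [norm_sub_rev x' x] at this
    linarith
  have h2 : ‖x - Y.1‖ ≤ 2 := (norm_sub_le _ _).trans (by linarith)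
  have h3 : ‖x' - Y.1‖ ≤ 2 := (norm_sub_le _ _).trans (by linarith)
  have h4 : ‖x' - Y.1‖ ^ 2 - ‖x - Y.1‖ ^ 2 ≤ 4 * ‖x - x'‖ := by
    nlinarith [norm_nonneg (x - x'), norm_nonneg (x - Y.1), norm_nonneg (x' - Y.1)]
  simp only [parab]
  nlinarith

lemma isCompact_contactProj (hΓ : IsClosed Γ) (hcyl : ∀ X ∈ Γ, ‖X.1‖ < 1)
    (hpos : ∀ X ∈ Γ, 0 ≤ X.2) {a : ℝ} (ha : 0 ≤ a) : IsCompact (contactProj n Γ a) := by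
  rcases Γ.eq_empty_or_nonempty with rfl | ⟨X₀, hX₀⟩
  · convert isCompact_empty
    ext x
    simp [contactProj, contactSet, TangentBelow]
  set C : Set ((EuclideanSpace ℝ (Fin n) × ℝ) × EuclideanSpace ℝ (Fin n)) :=
    ((closedBall 0 (3 / 4) ×ˢ Icc 0 (X₀.2 + 4 * a)) ×ˢ closedBall 0 1) ∩
      ({p | p.1 ∈ Γ} ∩ ⋂ X ∈ Γ, {p | p.1.2 + a / 2 * ‖p.1.1 - p.2‖ ^ 2 ≤
        X.2 + a / 2 * ‖X.1 - p.2‖ ^ 2})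
  have hC : IsCompact C := by
    refine (((isCompact_closedBall _ _).prod isCompact_Icc).prod
      (isCompact_closedBall _ _)).inter_right ((hΓ.preimage continuous_fst).inter ?_)
    exact isClosed_biInter fun X _ => isClosed_le (by fun_prop) (by fun_prop)
  have hEq : contactProj n Γ a = (fun p => p.1.1) '' C := by
    ext z
    constructor
    · rintro ⟨Z, ⟨hZ, Y, hY, hT⟩, rfl⟩
      refine ⟨(Z, Y.1), ⟨⟨⟨mem_closedBall_zero_iff.2 hZ, hpos _ hT.1, ?_⟩,
        mem_closedBall_zero_iff.2 hY⟩, hT.1, ?_⟩, rfl⟩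
      · have h1 := hT.2.2 X₀ hX₀
        have h2 := parab_sub_parab_le ha Y hY (hZ.trans (by norm_num)) (hcyl X₀ hX₀).le
        have h3 : ‖Z.1 - X₀.1‖ ≤ 2 :=
          (norm_sub_le _ _).trans (by have := (hcyl X₀ hX₀).le; linarith)
        have h4 := hT.2.1
        show Z.2 ≤ _
        nlinarith
      · simp only [mem_iInter, mem_ofPred_eq]
        intro X hX
        have h1 := hT.2.2 X hX
        have h2 := hT.2.1
        simp only [parab] at h1 h2
        linarith
    · rintro ⟨⟨Z, y⟩, ⟨⟨⟨hZ, -⟩, hy⟩, hZΓ, h⟩, rfl⟩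
      simp only [mem_iInter, mem_ofPred_eq] at h
      refine ⟨Z, ⟨mem_closedBall_zero_iff.1 hZ, (y, Z.2 + a / 2 * ‖Z.1 - y‖ ^ 2),
        mem_closedBall_zero_iff.1 hy, hZΓ, by simp [parab], fun X hX => ?_⟩, rfl⟩
      have := h X hX
      simp only [parab]
      linarith
  rw [hEq]
  exact hC.image (by fun_prop)

lemma mem_of_eventually_graph {Z : EuclideanSpace ℝ (Fin n) × ℝ} {r : ℝ}
    {v : EuclideanSpace ℝ (Fin n) → ℝ} (hv : Continuous v)
    (hg : Γ ∩ ball Z r = {X : EuclideanSpace ℝ (Fin n) × ℝ | X.2 = v X.1} ∩ ball Z r)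
    {Z' : EuclideanSpace ℝ (Fin n) × ℝ} (hZ' : Z' ∈ Γ) (hZ'r : Z' ∈ ball Z r) :
    Z'.2 = v Z'.1 ∧ ∀ᶠ x in nhds Z'.1, (x, v x) ∈ Γ := by
  have h1 : Z' ∈ {X : EuclideanSpace ℝ (Fin n) × ℝ | X.2 = v X.1} ∩ ball Z r := hg ▸ ⟨hZ', hZ'r⟩
  have h2 : Z'.2 = v Z'.1 := h1.1
  refine ⟨h2, ?_⟩
  have h3 : Continuous fun x => (x, v x) := by fun_prop
  have h4 : (Z'.1, v Z'.1) ∈ ball Z r := by rw [← h2]; exact hZ'r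
  filter_upwards [h3.continuousAt.preimage_mem_nhds (isOpen_ball.mem_nhds h4)] with x hx
  have h5 : (x, v x) ∈ {X : EuclideanSpace ℝ (Fin n) × ℝ | X.2 = v X.1} ∩ ball Z r := ⟨rfl, hx⟩
  rw [← hg] at h5
  exact h5.1

lemma hasFDerivAt_parab (a : ℝ) (Y : EuclideanSpace ℝ (Fin n) × ℝ) (x : EuclideanSpace ℝ (Fin n)) :
    HasFDerivAt (parab n a Y) (-a • innerSL ℝ (x - Y.1)) x := by
  have h := ((((hasFDerivAt_id x).sub_const Y.1).norm_sq).const_mul (-(a / 2))).add_const Y.2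
  refine h.congr_fderiv ?_
  ext w
  simp
  ring

/-- The gradient, as a linear isometric function of the differential. -/
def gradientMap (n : ℕ) :
    (EuclideanSpace ℝ (Fin n) →L[ℝ] ℝ) →ₗᵢ[ℝ] EuclideanSpace ℝ (Fin n) where
  toFun φ := (InnerProductSpace.toDual ℝ (EuclideanSpace ℝ (Fin n))).symm φ
  map_add' := by simp
  map_smul' := by simp
  norm_map' := by simp

/-- The center of a touching paraboloid is read off from the gradient at the contact point. -/
lemma TangentBelow.center_eq {a : ℝ} (ha : 0 < a) {Y Z : EuclideanSpace ℝ (Fin n) × ℝ}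
    (hT : TangentBelow n Γ a Y Z) {v : EuclideanSpace ℝ (Fin n) → ℝ} (hv : ContDiff ℝ 2 v)
    (hZ : Z.2 = v Z.1) (hΓ : ∀ᶠ x in nhds Z.1, (x, v x) ∈ Γ) :
    Y.1 = Z.1 + a⁻¹ • gradientMap n (fderiv ℝ v Z.1) := by
  have hmin : IsLocalMin (v - parab n a Y) Z.1 := by
    filter_upwards [hΓ] with x hx
    have h1 := hT.2.2 _ hx
    have h2 := hT.2.1
    simp only [Pi.sub_apply]
    linarith
  have hd := ((hv.differentiable (by norm_num)) Z.1).hasFDerivAt.sub (hasFDerivAt_parab a Y Z.1)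
  have h0 := hmin.hasFDerivAt_eq_zero hd
  have h1 : gradientMap n (fderiv ℝ v Z.1) = -a • (Z.1 - Y.1) := by
    rw [sub_eq_zero.1 h0, map_smul]
    congr 1
    exact (InnerProductSpace.toDual ℝ (EuclideanSpace ℝ (Fin n))).symm_apply_apply _
  rw [h1, smul_smul, mul_neg, inv_mul_cancel₀ ha.ne']
  module

lemma TangentBelow.height_sub_le {a : ℝ} (ha : 0 ≤ a) {Y Z Z' : EuclideanSpace ℝ (Fin n) × ℝ}
    (hT : TangentBelow n Γ a Y Z) (hY : ‖Y.1‖ ≤ 1) (hZ : ‖Z.1‖ ≤ 3 / 4) (hZ' : ‖Z'.1‖ ≤ 3 / 4)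
    (hZ'Γ : Z' ∈ Γ) : Z.2 - Z'.2 ≤ 2 * a * ‖Z.1 - Z'.1‖ := by
  have h1 := parab_sub_parab_le ha Y hY (hZ.trans (by norm_num)) (hZ'.trans (by norm_num))
  have h2 := hT.2.2 _ hZ'Γ
  have h3 := hT.2.1
  linarith

/-- Area estimate: the set of centers of touching paraboloids has measure controlled by the
measure of the projected contact set. -/
lemma volume_centers_le {Λ : ℝ} (hΛ : 0 < Λ) (hΓ : IsClosed Γ) (hcyl : ∀ X ∈ Γ, ‖X.1‖ < 1)
    (hpos : ∀ X ∈ Γ, 0 ≤ X.2) {a : ℝ} (ha : 0 < a) {I : Set ℝ} (haI : a ∈ I)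
    (hP : PropertyP n Γ Λ I) {V W : Set (EuclideanSpace ℝ (Fin n))} (hW : IsOpen W)
    (hV : ∀ y ∈ V, ‖y‖ ≤ 1 ∧
      ∃ k Z, Z.1 ∈ W ∧ ‖Z.1‖ ≤ 3 / 4 ∧ TangentBelow n Γ a (y, k) Z) :
    volume V ≤ ENNReal.ofReal ((1 + Λ) ^ n) * volume (contactProj n Γ a ∩ W) := by
  set S := contactProj n Γ a ∩ W
  have hS : MeasurableSet S :=
    (isCompact_contactProj hΓ hcyl hpos ha.le).measurableSet.inter hW.measurableSet
  have hex : ∀ z, ∃ p : (EuclideanSpace ℝ (Fin n) × ℝ) × (EuclideanSpace ℝ (Fin n) × ℝ),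
      z ∈ S → p.2.1 = z ∧ ‖z‖ ≤ 3 / 4 ∧ ‖p.1.1‖ ≤ 1 ∧ TangentBelow n Γ a p.1 p.2 := by
    intro z
    by_cases hz : z ∈ S
    · obtain ⟨Z, ⟨hZ, Y, hY, hT⟩, hZz⟩ := hz.1
      exact ⟨(Y, Z), fun _ => ⟨hZz, hZz ▸ hZ, hY, hT⟩⟩
    · exact ⟨0, fun h => absurd h hz⟩
  choose p hp using hex
  have key : ∀ z ∈ S, ∃ v : EuclideanSpace ℝ (Fin n) → ℝ, ContDiff ℝ 2 v ∧
      ‖iteratedFDeriv ℝ 2 v z‖ ≤ Λ * a ∧ ∀ᶠ z' in nhdsWithin z S, ∀ Y Z',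
        ‖Y.1‖ ≤ 1 → ‖Z'.1‖ ≤ 3 / 4 → Z'.1 = z' → TangentBelow n Γ a Y Z' →
          Y.1 = z' + a⁻¹ • gradientMap n (fderiv ℝ v z') := by
    intro z hz
    obtain ⟨hz1, hz2, hz3, hz4⟩ := hp z hz
    obtain ⟨r, hr, v, hv, hv2, hg⟩ := hP a haI _ _ hz3 (by rwa [hz1]) hz4
    refine ⟨v, hv, by rwa [hz1] at hv2, ?_⟩
    have hδ : 0 < min r (r / (2 * a)) := by positivity
    filter_upwards [mem_nhdsWithin_of_mem_nhds (ball_mem_nhds z hδ)]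
      with z' hz' Y Z' hY hZ' hZz' hT
    subst hZz'
    have hd : ‖Z'.1 - (p z).2.1‖ < min r (r / (2 * a)) := by
      rw [hz1, ← dist_eq_norm]; exact hz'
    have hd1 := (lt_min_iff.1 hd).1
    have hd2 := (lt_min_iff.1 hd).2
    rw [lt_div_iff₀ (by positivity)] at hd2
    have h1 := hT.height_sub_le ha.le hY hZ' (by rwa [hz1]) hz4.1
    have h2 := hz4.height_sub_le ha.le hz3 (by rwa [hz1]) hZ' hT.1
    rw [norm_sub_rev] at h2
    have hball : Z' ∈ ball (p z).2 r := by
      rw [mem_ball, Prod.dist_eq, max_lt_iff, dist_eq_norm, Real.dist_eq, abs_lt]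
      exact ⟨hd1, by linarith, by linarith⟩
    obtain ⟨e1, e2⟩ := mem_of_eventually_graph hv.continuous hg hT.1 hball
    exact hT.center_eq ha hv e1 e2
  choose! v hv hv2 hvT using key
  set f : EuclideanSpace ℝ (Fin n) → EuclideanSpace ℝ (Fin n) := fun z => (p z).1.1
  set f' : EuclideanSpace ℝ (Fin n) → (EuclideanSpace ℝ (Fin n) →L[ℝ] EuclideanSpace ℝ (Fin n)) :=
    fun z => ContinuousLinearMap.id ℝ _ + a⁻¹ •
      (gradientMap n).toContinuousLinearMap.comp (fderiv ℝ (fderiv ℝ (v z)) z)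
  have hf : ∀ z ∈ S, HasFDerivWithinAt f (f' z) S z := by
    intro z hz
    have hd : HasFDerivAt (fun x => x + a⁻¹ • gradientMap n (fderiv ℝ (v z) x)) (f' z) z := by
      have h1 : DifferentiableAt ℝ (fderiv ℝ (v z)) z :=
        ((hv z hz).fderiv_right (m := 1) (by norm_num)).differentiable (by norm_num) z
      exact (hasFDerivAt_id z).add
        (((gradientMap n).toContinuousLinearMap.hasFDerivAt.comp z h1.hasFDerivAt).const_smul a⁻¹)
    have heq : f =ᶠ[nhdsWithin z S] fun x => x + a⁻¹ • gradientMap n (fderiv ℝ (v z) x) := by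
      filter_upwards [hvT z hz, self_mem_nhdsWithin] with z' hz' hz'S
      obtain ⟨h1, h2, h3, h4⟩ := hp z' hz'S
      exact hz' _ _ h3 (by rwa [h1]) h1 h4
    exact hd.hasFDerivWithinAt.congr_of_eventuallyEq heq (heq.self_of_nhdsWithin hz)
  have hVf : V ⊆ f '' S := by
    intro y hy
    obtain ⟨hy1, k, Z, hZW, hZ, hT⟩ := hV y hy
    have hzS : Z.1 ∈ S := ⟨⟨Z, ⟨hZ, (y, k), hy1, hT⟩, rfl⟩, hZW⟩
    refine ⟨Z.1, hzS, ?_⟩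
    have h0 := (hvT Z.1 hzS).self_of_nhdsWithin hzS
    obtain ⟨h1, h2, h3, h4⟩ := hp Z.1 hzS
    exact (h0 _ _ h3 (by rwa [h1]) h1 h4).trans (h0 (y, k) Z hy1 hZ rfl hT).symm
  have hdet : ∀ z ∈ S, ENNReal.ofReal |(f' z).det| ≤ ENNReal.ofReal ((1 + Λ) ^ n) := by
    intro z hz
    refine ENNReal.ofReal_le_ofReal ?_
    have h1 : ‖fderiv ℝ (fderiv ℝ (v z)) z‖ ≤ Λ * a := by
      rw [← norm_iteratedFDeriv_one, norm_iteratedFDeriv_fderiv]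
      exact hv2 z hz
    have h2 : ‖f' z‖ ≤ 1 + Λ := by
      calc ‖f' z‖ ≤ ‖ContinuousLinearMap.id ℝ (EuclideanSpace ℝ (Fin n))‖ +
            ‖a⁻¹ • (gradientMap n).toContinuousLinearMap.comp
              (fderiv ℝ (fderiv ℝ (v z)) z)‖ := norm_add_le _ _
        _ ≤ 1 + a⁻¹ * (1 * (Λ * a)) := by
          refine add_le_add ContinuousLinearMap.norm_id_le ?_
          rw [norm_smul, norm_inv, Real.norm_of_nonneg ha.le]
          refine mul_le_mul_of_nonneg_left ?_ (by positivity)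
          exact (ContinuousLinearMap.opNorm_comp_le _ _).trans
            (mul_le_mul (gradientMap n).norm_toContinuousLinearMap_le h1 (norm_nonneg _) zero_le_one)
        _ = 1 + Λ := by field_simp
    simpa using abs_det_le_pow (f' z) h2
  calc volume V ≤ volume (f '' S) := measure_mono hVf
    _ ≤ ∫⁻ z in S, ENNReal.ofReal |(f' z).det| :=
      addHaar_image_le_lintegral_abs_det_fderiv volume hS hf
    _ ≤ ∫⁻ _ in S, ENNReal.ofReal ((1 + Λ) ^ n) := setLIntegral_mono measurable_const hdet
    _ = ENNReal.ofReal ((1 + Λ) ^ n) * volume S := setLIntegral_const _ _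

lemma second_deriv_along_line {v : EuclideanSpace ℝ (Fin n) → ℝ} (hv : ContDiff ℝ 2 v)
    (z e : EuclideanSpace ℝ (Fin n)) (he : ‖e‖ = 1) :
    ∃ (g : ℝ → ℝ) (c : ℝ), (∀ t, HasDerivAt (fun t : ℝ => v (z + t • e)) (g t) t) ∧
      HasDerivAt g c 0 ∧ c ≤ ‖iteratedFDeriv ℝ 2 v z‖ := by
  have hl : ∀ t : ℝ, HasDerivAt (fun t : ℝ => z + t • e) e t := fun t => by
    simpa using ((hasDerivAt_id t).smul_const e).const_add z
  have h1 : Differentiable ℝ (fderiv ℝ v) :=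
    (hv.fderiv_right (m := 1) (by norm_num)).differentiable (by norm_num)
  refine ⟨fun t => fderiv ℝ v (z + t • e) e, fderiv ℝ (fderiv ℝ v) z e e, fun t => ?_, ?_, ?_⟩
  · exact ((hv.differentiable (by norm_num)) _).hasFDerivAt.comp_hasDerivAt t (hl t)
  · have h2 : HasDerivAt (fun t : ℝ => fderiv ℝ v (z + t • e)) (fderiv ℝ (fderiv ℝ v) z e) 0 := by
      have := (h1 (z + (0 : ℝ) • e)).hasFDerivAt.comp_hasDerivAt 0 (hl 0)
      rw [zero_smul, add_zero] at this
      exact this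
    simpa using h2.clm_apply (hasDerivAt_const 0 e)
  · have h3 := (iteratedFDeriv ℝ 2 v z).le_opNorm ![e, e]
    rw [iteratedFDeriv_two_apply] at h3
    simp only [Matrix.cons_val_zero, Matrix.cons_val_one, Fin.prod_univ_two, he, mul_one] at h3
    exact (le_abs_self _).trans h3

/-- The normalized height of the barrier. -/
def barrierHeight (Λ : ℝ) : ℝ := Real.exp (288 * (Λ + 2))

/-- The factor by which the opening grows in one propagation step. -/
def openingFactor (Λ : ℝ) : ℝ := 1 + (Λ + 2) * barrierHeight Λ

/-- A Gaussian barrier with large exponent cannot touch `Γ` away from its center. -/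
lemma no_contact_gaussian {Λ : ℝ} (hΛ : 0 < Λ) {a b G : ℝ} (ha : 0 < a) (hb : 0 < b) (hG : 0 < G)
    {I : Set ℝ} (hP : PropertyP n Γ Λ I) {Y Z : EuclideanSpace ℝ (Fin n) × ℝ}
    {x₁ : EuclideanSpace ℝ (Fin n)} (hY : ‖Y.1‖ ≤ 1) (hx₁ : ‖x₁‖ ≤ 1) (hZ : ‖Z.1‖ ≤ 3 / 4)
    (hZΓ : Z ∈ Γ)
    (hmin : ∀ X ∈ Γ, Z.2 - (parab n a Y Z.1 + G * Real.exp (-b * ‖Z.1 - x₁‖ ^ 2)) ≤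
      X.2 - (parab n a Y X.1 + G * Real.exp (-b * ‖X.1 - x₁‖ ^ 2)))
    (hI : a + 2 * b * G * Real.exp (-b * ‖Z.1 - x₁‖ ^ 2) ∈ I)
    (hfar : Λ + 2 ≤ 2 * b * ‖Z.1 - x₁‖ ^ 2) :
    2 * b * G * Real.exp (-b * ‖Z.1 - x₁‖ ^ 2) ≤ (1 + Λ) * a := by
  set d := ‖Z.1 - x₁‖ with hd
  set w := Real.exp (-b * d ^ 2) with hw
  have hw0 : 0 < w := Real.exp_pos _
  set K := 2 * b * G * w with hK
  have hK0 : 0 < K := by positivity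
  have hd0 : 0 < d := by
    rcases (norm_nonneg (Z.1 - x₁)).eq_or_lt with h | h
    · rw [hd, ← h] at hfar; norm_num at hfar; linarith
    · exact h
  obtain ⟨k, hk⟩ := TangentBelow.add (Y := Y) (K := K) (a := a) (y := x₁) (by positivity) hZΓ
    fun X hX => by
      have h1 := hmin X hX
      have h2 : w * (-b * (‖X.1 - x₁‖ ^ 2 - d ^ 2) + 1) ≤ Real.exp (-b * ‖X.1 - x₁‖ ^ 2) := by
        have h3 := Real.add_one_le_exp (-b * (‖X.1 - x₁‖ ^ 2 - d ^ 2))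
        calc _ ≤ w * Real.exp (-b * (‖X.1 - x₁‖ ^ 2 - d ^ 2)) := by gcongr
          _ = _ := by rw [hw, ← Real.exp_add]; congr 1; ring
      have h4 := mul_le_mul_of_nonneg_left h2 hG.le
      rw [hK]
      linarith
  obtain ⟨r, hr, v, hv, hv2, hg⟩ := hP _ hI (_, k) Z
    (norm_weighted_mean_le_one ha hK0.le hY hx₁) hZ hk
  obtain ⟨hZv, hvΓ⟩ := mem_of_eventually_graph hv.continuous hg hZΓ (mem_ball_self hr)
  set e := d⁻¹ • (Z.1 - x₁) with he
  have he1 : ‖e‖ = 1 := by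
    rw [he, norm_smul, norm_inv, Real.norm_of_nonneg hd0.le, ← hd, inv_mul_cancel₀ hd0.ne']
  obtain ⟨g, c, hg1, hg2, hc⟩ := second_deriv_along_line hv Z.1 e he1
  have hx₁e : ∀ t : ℝ, ‖Z.1 + t • e - x₁‖ ^ 2 = (d + t) ^ 2 := by
    intro t
    have : Z.1 + t • e - x₁ = (d + t) • e := by
      have h1 : Z.1 - x₁ = d • e := by rw [he, smul_smul, mul_inv_cancel₀ hd0.ne', one_smul]
      rw [add_smul, ← h1]; abel
    rw [this, norm_smul, he1, mul_one, Real.norm_eq_abs, sq_abs]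
  set κ : ℝ := inner ℝ (Z.1 - Y.1) e
  have hYe : ∀ t : ℝ, ‖Z.1 + t • e - Y.1‖ ^ 2 = ‖Z.1 - Y.1‖ ^ 2 + 2 * t * κ + t ^ 2 := by
    intro t
    have : Z.1 + t • e - Y.1 = (Z.1 - Y.1) + t • e := by abel
    rw [this, norm_add_sq_real, norm_smul, he1, real_inner_smul_right, mul_one,
      Real.norm_eq_abs, sq_abs]
    ring
  set F : ℝ → ℝ := fun t => v (Z.1 + t • e) - (-(a / 2) * (‖Z.1 - Y.1‖ ^ 2 + 2 * t * κ + t ^ 2) +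
    Y.2 + G * Real.exp (-b * (d + t) ^ 2)) with hF
  have hFmin : IsLocalMin F 0 := by
    have hl : Filter.Tendsto (fun t : ℝ => Z.1 + t • e) (nhds 0) (nhds Z.1) := by
      have : Continuous fun t : ℝ => Z.1 + t • e := by fun_prop
      simpa using this.tendsto 0
    filter_upwards [hl.eventually hvΓ] with t ht
    have h1 := hmin _ ht
    simp only [parab, hx₁e, hYe] at h1
    simp only [hF, zero_smul, add_zero, ← hZv, mul_zero, zero_mul]
    simp only [ne_eq, OfNat.ofNat_ne_zero, not_false_eq_true, zero_pow, add_zero]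
    exact h1
  have hF1 : ∀ t, HasDerivAt F (g t - (-(a / 2) * (2 * κ + 2 * t) +
      G * (Real.exp (-b * (d + t) ^ 2) * (-b * (2 * (d + t)))))) t := by
    intro t
    have h2 : HasDerivAt (fun t : ℝ => -b * (d + t) ^ 2) (-b * (2 * (d + t))) t := by
      simpa using (((hasDerivAt_id t).const_add d).pow 2).const_mul (-b)
    have h3 : HasDerivAt (fun t : ℝ => ‖Z.1 - Y.1‖ ^ 2 + 2 * t * κ + t ^ 2)
        (2 * κ + 2 * t) t := by
      have := ((((hasDerivAt_id t).const_mul 2).mul_const κ).const_add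
        (‖Z.1 - Y.1‖ ^ 2)).add ((hasDerivAt_id t).pow 2)
      exact this.congr_deriv (by simp)
    exact (hg1 t).sub (((h3.const_mul _).add_const _).add (h2.exp.const_mul G))
  have hF2 : HasDerivAt (fun t => g t - (-(a / 2) * (2 * κ + 2 * t) +
      G * (Real.exp (-b * (d + t) ^ 2) * (-b * (2 * (d + t))))))
      (c - (-(a / 2) * 2 + G * (w * (-b * (2 * d)) * (-b * (2 * d)) + w * (-b * 2)))) 0 := by
    have h2 : HasDerivAt (fun t : ℝ => -b * (d + t) ^ 2) (-b * (2 * d)) 0 := by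
      simpa using (((hasDerivAt_id (0 : ℝ)).const_add d).pow 2).const_mul (-b)
    have h3 : HasDerivAt (fun t : ℝ => -b * (2 * (d + t))) (-b * 2) 0 := by
      simpa using ((((hasDerivAt_id (0 : ℝ)).const_add d).const_mul 2).const_mul (-b))
    have h4 : HasDerivAt (fun t : ℝ => 2 * κ + 2 * t) 2 0 := by
      simpa using (((hasDerivAt_id (0 : ℝ)).const_mul 2).const_add (2 * κ))
    have h5 := hg2.sub ((h4.const_mul (-(a / 2))).add ((h2.exp.mul h3).const_mul G))
    exact h5.congr_deriv (by simp [hw])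
  have hfin := hFmin.second_deriv_nonneg (Filter.Eventually.of_forall hF1) hF2
  have h6 : c ≤ Λ * (a + K) := hc.trans hv2
  have h7 : K * (Λ + 1) ≤ K * (2 * b * d ^ 2 - 1) := by gcongr; linarith
  have h8 : -a + K * (2 * b * d ^ 2 - 1) ≤ c := by rw [hK]; linarith
  linarith

/-- Near any base point in reach of a contact point, `Γ` has a point not much above the touching
paraboloid. -/
lemma exists_low_point {Λ : ℝ} (hΛ : 0 < Λ) (hΓ : IsClosed Γ) (hcyl : ∀ X ∈ Γ, ‖X.1‖ < 1)
    (hpos : ∀ X ∈ Γ, 0 ≤ X.2) {a s : ℝ} (ha : 0 < a) (hs : 0 < s)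
    (hP : PropertyP n Γ Λ (Icc a (openingFactor Λ * a)))
    {Y Z : EuclideanSpace ℝ (Fin n) × ℝ} {x₁ : EuclideanSpace ℝ (Fin n)} (hY : ‖Y.1‖ ≤ 1)
    (hT : TangentBelow n Γ a Y Z) (hx₁ : ‖x₁‖ + 24 * s ≤ 3 / 4) (hZx₁ : ‖Z.1 - x₁‖ ≤ 20 * s) :
    ∃ Z₁ ∈ Γ, ‖Z₁.1 - x₁‖ < s ∧ Z₁.2 ≤ parab n a Y Z₁.1 + barrierHeight Λ * a * s ^ 2 := by
  set A := barrierHeight Λ with hA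
  have hA0 : 0 < A := Real.exp_pos _
  set b := (Λ + 2) / (2 * s ^ 2) with hb
  have hb0 : 0 < b := by positivity
  have hbs : 2 * b * s ^ 2 = Λ + 2 := by rw [hb]; field_simp
  set G := A * a * s ^ 2 with hG
  have hG0 : 0 < G := by positivity
  have hpar : Continuous (parab n a Y) := by unfold parab; fun_prop
  obtain ⟨Z₁, hZ₁, hmin⟩ := exists_min_height_sub hΓ hcyl hpos ⟨Z, hT.1⟩
    (ψ := fun x => parab n a Y x + G * Real.exp (-b * ‖x - x₁‖ ^ 2)) (by fun_prop)
  have h1 : Real.exp (-b * (24 * s) ^ 2) < Real.exp (-b * ‖Z₁.1 - x₁‖ ^ 2) := by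
    have h2 : Real.exp (-b * (24 * s) ^ 2) < Real.exp (-b * ‖Z.1 - x₁‖ ^ 2) := by
      refine Real.exp_lt_exp.2 ?_
      have h4 : ‖Z.1 - x₁‖ ^ 2 < (24 * s) ^ 2 := by
        refine pow_lt_pow_left₀ (by linarith) (norm_nonneg _) (by norm_num)
      nlinarith
    have h3 := hmin Z hT.1
    have h4 := hT.2.1
    have h5 := hT.2.2 Z₁ hZ₁
    have h6 : G * Real.exp (-b * ‖Z.1 - x₁‖ ^ 2) ≤ G * Real.exp (-b * ‖Z₁.1 - x₁‖ ^ 2) := by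
      linarith
    exact h2.trans_le (le_of_mul_le_mul_left h6 hG0)
  have hlow : Z₁.2 ≤ parab n a Y Z₁.1 + G := by
    have h3 := hmin Z hT.1
    have h4 := hT.2.1
    have h5 : 0 < G * Real.exp (-b * ‖Z.1 - x₁‖ ^ 2) := by positivity
    have h6 : G * Real.exp (-b * ‖Z₁.1 - x₁‖ ^ 2) ≤ G * 1 := by
      gcongr
      exact Real.exp_le_one_iff.2 (by nlinarith [sq_nonneg ‖Z₁.1 - x₁‖])
    linarith
  refine ⟨Z₁, hZ₁, ?_, hlow⟩
  by_contra! hfar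
  have h2 : ‖Z₁.1 - x₁‖ < 24 * s := by
    have h3 := Real.exp_lt_exp.1 h1
    refine lt_of_pow_lt_pow_left₀ 2 (by positivity) ?_
    nlinarith
  have h24 : b * (24 * s) ^ 2 = 288 * (Λ + 2) := by nlinarith
  have hexp : A * Real.exp (-b * (24 * s) ^ 2) = 1 := by
    rw [neg_mul, h24, hA, barrierHeight, ← Real.exp_add]; simp
  have hbG : 2 * b * G = (Λ + 2) * A * a := by rw [← hbs, hG]; ring
  have hle : Real.exp (-b * ‖Z₁.1 - x₁‖ ^ 2) ≤ 1 :=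
    Real.exp_le_one_iff.2 (by nlinarith [sq_nonneg ‖Z₁.1 - x₁‖])
  have hcon := no_contact_gaussian hΛ ha hb0 hG0 hP hY (x₁ := x₁) (by linarith) (Z := Z₁)
    (by have := norm_sub_norm_le Z₁.1 x₁; linarith) hZ₁ hmin
    (by
      refine ⟨by have : 0 < 2 * b * G * Real.exp (-b * ‖Z₁.1 - x₁‖ ^ 2) := by positivity
                 linarith, ?_⟩
      have : 2 * b * G * Real.exp (-b * ‖Z₁.1 - x₁‖ ^ 2) ≤ 2 * b * G * 1 := by gcongr
      rw [openingFactor]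
      linarith)
    (by rw [← hbs]; gcongr)
  have h5 : 2 * b * G * Real.exp (-b * (24 * s) ^ 2) <
      2 * b * G * Real.exp (-b * ‖Z₁.1 - x₁‖ ^ 2) := by gcongr
  have h6 : 2 * b * G * Real.exp (-b * (24 * s) ^ 2) = (Λ + 2) * a := by
    rw [hbG]
    linear_combination (Λ + 2) * a * hexp
  nlinarith

/-- Propagation of contact points: a contact point within distance `20 s` of `x₁` produces a
definite proportion of contact points, for a larger opening, within distance `4 s` of `x₁`. -/
lemma volume_ball_le_of_contact {Λ : ℝ} (hΛ : 0 < Λ) (hΓ : IsClosed Γ)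
    (hcyl : ∀ X ∈ Γ, ‖X.1‖ < 1) (hpos : ∀ X ∈ Γ, 0 ≤ X.2) {a s : ℝ} (ha : 0 < a) (hs : 0 < s)
    (hP : PropertyP n Γ Λ (Icc a (openingFactor Λ * a)))
    {z x₁ : EuclideanSpace ℝ (Fin n)} (hz : z ∈ contactProj n Γ a)
    (hx₁ : ‖x₁‖ + 24 * s ≤ 3 / 4) (hzx₁ : ‖z - x₁‖ ≤ 20 * s) :
    ∃ y₀ : EuclideanSpace ℝ (Fin n), volume (ball y₀ (s / 2)) ≤ ENNReal.ofReal ((1 + Λ) ^ n) *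
      volume (contactProj n Γ (openingFactor Λ * a) ∩ ball x₁ (4 * s)) := by
  obtain ⟨Z, ⟨hZ, Y, hY, hT⟩, rfl⟩ := hz
  obtain ⟨Z₁, hZ₁, hZ₁x, hlow⟩ := exists_low_point hΛ hΓ hcyl hpos ha hs hP hY hT hx₁ hzx₁
  set A := barrierHeight Λ with hA
  have hA1 : 1 ≤ A := Real.one_le_exp (by positivity)
  set K := (Λ + 2) * A * a with hK
  have hK0 : 0 < K := by positivity
  have hCa : openingFactor Λ * a = a + K := by rw [openingFactor, hK]; ring
  have hKa : a ≤ K := by rw [hK]; nlinarith [mul_le_mul_of_nonneg_right hA1 ha.le]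
  rw [hCa] at hP ⊢
  refine ⟨(a + K)⁻¹ • (a • Y.1 + K • x₁), volume_centers_le hΛ hΓ hcyl hpos (by positivity)
    (right_mem_Icc.2 (by linarith)) hP isOpen_ball ?_⟩
  intro q hq
  have haK : 0 < a + K := by positivity
  set y := x₁ + (K⁻¹ * (a + K)) • (q - (a + K)⁻¹ • (a • Y.1 + K • x₁)) with hy
  have hqy : (a + K)⁻¹ • (a • Y.1 + K • y) = q := by
    have h1 : K • y = K • x₁ + (a + K) • q - (a • Y.1 + K • x₁) := by
      rw [hy, smul_add, smul_smul, mul_inv_cancel_left₀ hK0.ne', smul_sub, smul_inv_smul₀ haK.ne']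
      abel
    have h2 : a • Y.1 + K • y = (a + K) • q := by rw [h1]; abel
    rw [h2, inv_smul_smul₀ haK.ne']
  have hyx : ‖y - x₁‖ < s := by
    rw [hy, add_sub_cancel_left, norm_smul, Real.norm_of_nonneg (by positivity)]
    have h1 := mem_ball_iff_norm.1 hq
    have h2 : K⁻¹ * (a + K) ≤ 2 := by
      rw [inv_mul_le_iff₀ hK0]; linarith
    have h3 := norm_nonneg (q - (a + K)⁻¹ • (a • Y.1 + K • x₁))
    nlinarith
  have hy1 : ‖y‖ ≤ 1 := by have := norm_sub_norm_le y x₁; linarith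
  refine ⟨hqy ▸ norm_weighted_mean_le_one ha hK0.le hY hy1, ?_⟩
  have hpar : Continuous (parab n a Y) := by unfold parab; fun_prop
  obtain ⟨Z₂, hZ₂, hmin⟩ := exists_min_height_sub hΓ hcyl hpos ⟨Z, hT.1⟩
    (ψ := fun x => parab n a Y x - K / 2 * ‖x - y‖ ^ 2) (by fun_prop)
  obtain ⟨k, hk⟩ := TangentBelow.add (Y := Y) (K := K) (a := a) (y := y) haK.ne' hZ₂
    fun X hX => by linarith [hmin X hX]
  have hnear : ‖Z₂.1 - x₁‖ < 4 * s := by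
    by_contra! hfar
    have h1 := hmin Z₁ hZ₁
    have h2 := hT.2.2 Z₂ hZ₂
    have h3 : ‖Z₁.1 - y‖ ≤ 2 * s := by
      have := norm_sub_le_norm_sub_add_norm_sub Z₁.1 x₁ y
      rw [norm_sub_rev x₁ y] at this
      linarith
    have h4 : 3 * s ≤ ‖Z₂.1 - y‖ := by
      have := norm_sub_le_norm_sub_add_norm_sub Z₂.1 y x₁
      linarith
    have h5 : ‖Z₁.1 - y‖ ^ 2 ≤ (2 * s) ^ 2 := pow_le_pow_left₀ (norm_nonneg _) h3 2
    have h6 : (3 * s) ^ 2 ≤ ‖Z₂.1 - y‖ ^ 2 := pow_le_pow_left₀ (by positivity) h4 2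
    have h7 : K / 2 * ‖Z₁.1 - y‖ ^ 2 ≤ K / 2 * (2 * s) ^ 2 := by gcongr
    have h8 : K / 2 * (3 * s) ^ 2 ≤ K / 2 * ‖Z₂.1 - y‖ ^ 2 := by gcongr
    have h9 : A * a * s ^ 2 * (2 + Λ) * (5 / 2) ≤ A * a * s ^ 2 := by rw [hK] at h7 h8; linarith
    have h10 : 0 < A * a * s ^ 2 := by positivity
    nlinarith
  rw [hqy] at hk
  exact ⟨k, Z₂, mem_ball_iff_norm.2 hnear,
    by have := norm_sub_norm_le Z₂.1 x₁; linarith, hk⟩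

lemma PropertyP.mono {Λ : ℝ} {I J : Set ℝ} (hP : PropertyP n Γ Λ J) (h : I ⊆ J) :
    PropertyP n Γ Λ I := fun a ha => hP a (h ha)

lemma one_le_openingFactor {Λ : ℝ} (hΛ : 0 < Λ) : 1 ≤ openingFactor Λ := by
  have : 0 < barrierHeight Λ := Real.exp_pos _
  rw [openingFactor]
  nlinarith

/-- A steep paraboloid centered at a low point of `Γ` touches close to that point. -/
lemma exists_contact_near_low_point (hΓ : IsClosed Γ) (hcyl : ∀ X ∈ Γ, ‖X.1‖ < 1)
    (hpos : ∀ X ∈ Γ, 0 ≤ X.2) {θ : ℝ} (hθ : 0 < θ) {Z : EuclideanSpace ℝ (Fin n) × ℝ}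
    (hZΓ : Z ∈ Γ) (hZ : ‖Z.1‖ < 1 / 2) (hZθ : Z.2 ≤ θ) :
    ∃ z ∈ contactProj n Γ (1000 * θ), ‖z - Z.1‖ ≤ 1 / 20 := by
  obtain ⟨h, Z', hT⟩ := exists_tangentBelow hΓ hcyl hpos ⟨Z, hZΓ⟩ (1000 * θ) Z.1
  have hnear : ‖Z'.1 - Z.1‖ ≤ 1 / 20 := by
    have h1 := hT.2.1
    have h2 := hT.2.2 Z hZΓ
    have h3 := hpos Z' hT.1
    simp only [parab, sub_self, norm_zero] at h1 h2
    by_contra! h4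
    have h5 : (1 / 20 : ℝ) ^ 2 < ‖Z'.1 - Z.1‖ ^ 2 := by gcongr
    nlinarith
  have := norm_sub_norm_le Z'.1 Z.1
  exact ⟨Z'.1, ⟨Z', ⟨by linarith, (Z.1, h), by linarith, hT⟩, rfl⟩, hnear⟩

/-- Chaining the propagation step: after twenty steps the contact set is `1/20`-dense in
`B_{1/2}`. -/
lemma exists_contact_near {Λ : ℝ} (hΛ : 0 < Λ) (hΓ : IsClosed Γ) (hcyl : ∀ X ∈ Γ, ‖X.1‖ < 1)
    (hpos : ∀ X ∈ Γ, 0 ≤ X.2) {a : ℝ} (ha : 0 < a) {z₀ x : EuclideanSpace ℝ (Fin n)}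
    (hz₀ : z₀ ∈ ball 0 (1 / 2)) (hx : x ∈ ball 0 (1 / 2))
    (hnear : ∃ z ∈ contactProj n Γ a, ‖z - z₀‖ ≤ 1 / 20)
    (hP : ∀ j < 20, PropertyP n Γ Λ
      (Icc (openingFactor Λ ^ j * a) (openingFactor Λ ^ (j + 1) * a))) :
    ∃ z ∈ contactProj n Γ (openingFactor Λ ^ 20 * a), ‖z - x‖ ≤ 1 / 20 := by
  have hC := one_le_openingFactor hΛ
  have key : ∀ j : ℕ, j ≤ 20 → ∃ z ∈ contactProj n Γ (openingFactor Λ ^ j * a),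
      ‖z - (z₀ + ((j : ℝ) / 20) • (x - z₀))‖ ≤ 1 / 20 := by
    intro j
    induction j with
    | zero => simpa using hnear
    | succ j ih =>
      intro hj
      obtain ⟨z, hz, hzj⟩ := ih (by omega)
      set p := z₀ + (((j + 1 : ℕ) : ℝ) / 20) • (x - z₀) with hp
      have hp1 : ‖p‖ < 1 / 2 := by
        rw [← mem_ball_zero_iff]
        refine (convex_ball (0 : EuclideanSpace ℝ (Fin n)) (1 / 2)).add_smul_sub_mem hz₀ hx
          ⟨by positivity, ?_⟩
        rw [div_le_one (by norm_num)]
        exact_mod_cast hj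
      have hpz : ‖z - p‖ ≤ 20 * (1 / 200) := by
        have h1 : z - p = (z - (z₀ + ((j : ℝ) / 20) • (x - z₀))) - (1 / 20 : ℝ) • (x - z₀) := by
          rw [hp]; push_cast; module
        have h2 : ‖x - z₀‖ ≤ 1 := by
          have h3 := mem_ball_zero_iff.1 hz₀
          have h4 := mem_ball_zero_iff.1 hx
          exact (norm_sub_le _ _).trans (by linarith)
        rw [h1]
        refine (norm_sub_le _ _).trans ?_
        rw [norm_smul, Real.norm_of_nonneg (by norm_num)]
        linarith
      have hP' := hP j (by omega)
      rw [pow_succ', mul_assoc] at hP'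
      obtain ⟨y₀, hy₀⟩ := volume_ball_le_of_contact hΛ hΓ hcyl hpos (a := openingFactor Λ ^ j * a)
        (s := 1 / 200) (by positivity) (by norm_num) hP' hz (x₁ := p) (by linarith) hpz
      have hne : (contactProj n Γ (openingFactor Λ * (openingFactor Λ ^ j * a)) ∩
          ball p (4 * (1 / 200))).Nonempty := by
        rw [nonempty_iff_ne_empty]
        intro h0
        rw [h0, measure_empty, mul_zero] at hy₀
        exact (measure_ball_pos volume y₀ (by norm_num)).not_ge hy₀
      obtain ⟨z', hz', hz'p⟩ := hne
      refine ⟨z', by rwa [pow_succ', mul_assoc], ?_⟩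
      have := mem_ball_iff_norm.1 hz'p
      linarith
  obtain ⟨z, hz, hzx⟩ := key 20 le_rfl
  refine ⟨z, hz, ?_⟩
  convert hzx using 2
  norm_num

/-- Covering argument: a fixed proportion of the complement of the contact set is filled in when
the opening grows by a fixed factor. -/
lemma volume_diff_le_mul {Λ : ℝ} (hΛ : 0 < Λ) (hΓ : IsClosed Γ) (hcyl : ∀ X ∈ Γ, ‖X.1‖ < 1)
    (hpos : ∀ X ∈ Γ, 0 ≤ X.2) {a : ℝ} (ha : 0 < a)
    (hP : PropertyP n Γ Λ (Icc a (openingFactor Λ * a)))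
    (hnear : ∀ x ∈ ball (0 : EuclideanSpace ℝ (Fin n)) (1 / 2),
      ∃ z ∈ contactProj n Γ a, ‖z - x‖ ≤ 1 / 20) :
    volume (ball 0 (1 / 2) \ contactProj n Γ a) ≤ ENNReal.ofReal ((80 * (1 + Λ)) ^ n) *
      volume ((ball 0 (1 / 2) \ contactProj n Γ a) ∩ contactProj n Γ (openingFactor Λ * a)) := by
  set F := contactProj n Γ a
  set F' := contactProj n Γ (openingFactor Λ * a)
  set U := ball (0 : EuclideanSpace ℝ (Fin n)) (1 / 2) \ F
  have hC := one_le_openingFactor hΛ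
  have hFc : IsCompact F := isCompact_contactProj hΓ hcyl hpos ha.le
  have hF' : MeasurableSet F' :=
    (isCompact_contactProj hΓ hcyl hpos (by positivity)).measurableSet
  have hU : MeasurableSet U := measurableSet_ball.diff hFc.measurableSet
  set r : EuclideanSpace ℝ (Fin n) → ℝ := fun x => infDist x F
  have hr : ∀ x ∈ U, 0 < r x ∧ r x ≤ 1 / 20 := by
    intro x hx
    obtain ⟨z, hz, hzx⟩ := hnear x hx.1
    refine ⟨(hFc.isClosed.notMem_iff_infDist_pos ⟨z, hz⟩).1 hx.2, ?_⟩
    refine (infDist_le_dist_of_mem hz).trans ?_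
    rwa [dist_comm, dist_eq_norm]
  have hball : ∀ x ∈ U, volume (closedBall x (5 * (r x / 2))) ≤
      ENNReal.ofReal ((80 * (1 + Λ)) ^ n) * volume (U ∩ F' ∩ closedBall x (r x / 2)) := by
    intro x hx
    obtain ⟨hr0, hr1⟩ := hr x hx
    obtain ⟨z', hz', -⟩ := hnear x hx.1
    obtain ⟨z, hz, hzx⟩ := hFc.exists_infDist_eq_dist ⟨z', hz'⟩ x
    have hzx' : ‖z - x‖ = r x := by rw [← dist_eq_norm, dist_comm]; exact hzx.symm
    have hx2 := mem_ball_zero_iff.1 hx.1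
    set x₁ := (1 - r x / 2) • x with hx₁
    have hx₁x : ‖x - x₁‖ ≤ r x / 4 := by
      have : x - x₁ = (r x / 2) • x := by rw [hx₁]; module
      rw [this, norm_smul, Real.norm_of_nonneg (by positivity)]
      nlinarith
    have hx₁n : ‖x₁‖ ≤ 1 / 2 - r x / 4 := by
      rw [hx₁, norm_smul, Real.norm_of_nonneg (by linarith)]
      nlinarith
    obtain ⟨y₀, hy₀⟩ := volume_ball_le_of_contact hΛ hΓ hcyl hpos ha (s := r x / 16)
      (by positivity) hP hz (x₁ := x₁) (by linarith)
      (by have := norm_sub_le_norm_sub_add_norm_sub z x x₁; linarith)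
    have hsub : F' ∩ ball x₁ (4 * (r x / 16)) ⊆ U ∩ F' ∩ closedBall x (r x / 2) := by
      rintro w ⟨hw, hwx₁⟩
      rw [mem_ball_iff_norm] at hwx₁
      have hwx : ‖w - x‖ ≤ r x / 2 := by
        have := norm_sub_le_norm_sub_add_norm_sub w x₁ x
        rw [norm_sub_rev x₁ x] at this
        linarith
      refine ⟨⟨⟨?_, fun hwF => ?_⟩, hw⟩, mem_closedBall_iff_norm.2 hwx⟩
      · rw [mem_ball_zero_iff]
        have := norm_sub_norm_le w x₁
        linarith
      · have h1 : r x ≤ dist x w := infDist_le_dist_of_mem hwF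
        rw [dist_comm, dist_eq_norm] at h1
        linarith
    have hvol : volume (closedBall x (5 * (r x / 2))) =
        ENNReal.ofReal (80 ^ n) * volume (ball y₀ (r x / 16 / 2)) := by
      rw [Measure.addHaar_closedBall volume x (by positivity : 0 ≤ 5 * (r x / 2)),
        Measure.addHaar_ball_of_pos volume y₀ (by positivity : 0 < r x / 16 / 2), ← mul_assoc,
        ← ENNReal.ofReal_mul (by positivity), finrank_euclideanSpace_fin, ← mul_pow,
        show 80 * (r x / 16 / 2) = 5 * (r x / 2) by ring]
    calc volume (closedBall x (5 * (r x / 2)))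
        = ENNReal.ofReal (80 ^ n) * volume (ball y₀ (r x / 16 / 2)) := hvol
      _ ≤ ENNReal.ofReal (80 ^ n) * (ENNReal.ofReal ((1 + Λ) ^ n) *
            volume (U ∩ F' ∩ closedBall x (r x / 2))) := by
          gcongr
          exact hy₀.trans (by gcongr)
      _ = _ := by
          rw [← mul_assoc, ← ENNReal.ofReal_mul (by positivity), ← mul_pow]
  obtain ⟨u, huU, hdisj, hcov⟩ := Vitali.exists_disjoint_subfamily_covering_enlargement_closedBall
    U (fun x => x) (fun x => r x / 2) (1 / 40) (fun x hx => by linarith [(hr x hx).2]) 5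
    (by norm_num)
  have hcount : u.Countable := hdisj.countable_of_nonempty_interior fun x hx =>
    ⟨x, ball_subset_interior_closedBall (mem_ball_self (by linarith [(hr x (huU hx)).1]))⟩
  calc volume U ≤ volume (⋃ x ∈ u, closedBall x (5 * (r x / 2))) := by
        refine measure_mono fun x hx => ?_
        obtain ⟨y, hy, hxy⟩ := hcov x hx
        exact mem_biUnion hy (hxy (mem_closedBall_self (by linarith [(hr x hx).1])))
    _ ≤ ∑' x : u, volume (closedBall (x : EuclideanSpace ℝ (Fin n)) (5 * (r x / 2))) :=
        measure_biUnion_le _ hcount _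
    _ ≤ ∑' x : u, ENNReal.ofReal ((80 * (1 + Λ)) ^ n) *
          volume (U ∩ F' ∩ closedBall (x : EuclideanSpace ℝ (Fin n)) (r x / 2)) :=
        ENNReal.tsum_le_tsum fun x => hball x (huU x.2)
    _ = ENNReal.ofReal ((80 * (1 + Λ)) ^ n) *
          volume (⋃ x ∈ u, U ∩ F' ∩ closedBall x (r x / 2)) := by
        rw [ENNReal.tsum_mul_left, measure_biUnion hcount]
        · exact hdisj.mono fun x => inter_subset_right
        · exact fun x _ => (hU.inter hF').inter measurableSet_closedBall
    _ ≤ _ := by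
        gcongr
        exact iUnion₂_subset fun x _ => inter_subset_left

/-- Geometric decay of the measure of the complement of the contact sets. -/
lemma volume_diff_le_geometric {Λ : ℝ} (hΛ : 0 < Λ) (hΓ : IsClosed Γ)
    (hcyl : ∀ X ∈ Γ, ‖X.1‖ < 1) (hpos : ∀ X ∈ Γ, 0 ≤ X.2) {a : ℝ} (ha : 0 < a) (k : ℕ)
    (hP : ∀ j < k, PropertyP n Γ Λ
      (Icc (openingFactor Λ ^ j * a) (openingFactor Λ ^ (j + 1) * a)))
    (hnear : ∀ x ∈ ball (0 : EuclideanSpace ℝ (Fin n)) (1 / 2),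
      ∃ z ∈ contactProj n Γ a, ‖z - x‖ ≤ 1 / 20) :
    volume.real (ball 0 (1 / 2) \ contactProj n Γ (openingFactor Λ ^ k * a)) ≤
      (1 - ((80 * (1 + Λ)) ^ n)⁻¹) ^ k *
        volume.real (ball (0 : EuclideanSpace ℝ (Fin n)) (1 / 2)) := by
  have hC := one_le_openingFactor hΛ
  set L : ℝ := (80 * (1 + Λ)) ^ n with hL
  have hL1 : 1 ≤ L := one_le_pow₀ (by linarith)
  have hq : 0 ≤ 1 - L⁻¹ := sub_nonneg.2 (inv_le_one_of_one_le₀ hL1)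
  have hfin : ∀ S : Set (EuclideanSpace ℝ (Fin n)), S ⊆ ball 0 (1 / 2) → volume S ≠ ⊤ :=
    fun S hS => ((measure_mono hS).trans_lt measure_ball_lt_top).ne
  induction k with
  | zero =>
    simp only [pow_zero, one_mul]
    exact measureReal_mono sdiff_subset (hfin _ subset_rfl)
  | succ k ih =>
    have ih' := ih fun j hj => hP j (by omega)
    set b := openingFactor Λ ^ k * a with hb
    have hab : a ≤ b := le_mul_of_one_le_left ha.le (one_le_pow₀ hC)
    have hb0 : 0 < b := ha.trans_le hab
    have hPk := hP k (by omega)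
    rw [pow_succ', mul_assoc, ← hb] at hPk
    rw [pow_succ' (openingFactor Λ), mul_assoc, ← hb]
    set U := ball (0 : EuclideanSpace ℝ (Fin n)) (1 / 2) \ contactProj n Γ b
    set F' := contactProj n Γ (openingFactor Λ * b)
    have hF' : MeasurableSet F' :=
      (isCompact_contactProj hΓ hcyl hpos (by positivity)).measurableSet
    have hstep : volume U ≤ ENNReal.ofReal L * volume (U ∩ F') :=
      volume_diff_le_mul hΛ hΓ hcyl hpos hb0 hPk fun x hx => by
        obtain ⟨z, hz, hzx⟩ := hnear x hx
        exact ⟨z, contactProj_mono ha hab hz, hzx⟩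
    have hUfin : volume (U ∩ F') ≠ ⊤ := hfin _ (inter_subset_left.trans sdiff_subset)
    have h1 : volume.real U ≤ L * volume.real (U ∩ F') := by
      have := ENNReal.toReal_mono (ENNReal.mul_ne_top ENNReal.ofReal_ne_top hUfin) hstep
      rwa [ENNReal.toReal_mul, ENNReal.toReal_ofReal (by positivity)] at this
    have h2 : volume.real (U ∩ F') + volume.real (U \ F') = volume.real U :=
      measureReal_inter_add_sdiff hF' (hfin _ sdiff_subset)
    have h3 : ball 0 (1 / 2) \ F' ⊆ U \ F' := fun x hx =>
      ⟨⟨hx.1, fun h => hx.2 (contactProj_mono hb0 (le_mul_of_one_le_left hb0.le hC) h)⟩, hx.2⟩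
    have h4 : volume.real (U \ F') ≤ (1 - L⁻¹) * volume.real U := by
      have : L⁻¹ * volume.real U ≤ volume.real (U ∩ F') := by
        rwa [inv_mul_le_iff₀ (by positivity)]
      linarith
    calc volume.real (ball 0 (1 / 2) \ F') ≤ volume.real (U \ F') :=
          measureReal_mono h3 (hfin _ (sdiff_subset.trans sdiff_subset))
      _ ≤ (1 - L⁻¹) * volume.real U := h4
      _ ≤ (1 - L⁻¹) * ((1 - L⁻¹) ^ k *
          volume.real (ball (0 : EuclideanSpace ℝ (Fin n)) (1 / 2))) := by gcongr
      _ = _ := by rw [pow_succ']; ring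

end ContactSets

/-- weak Harnack inequality: if `Γ ⊂ {x_{n+1} ≥ 0}` meets
`B_{1/2} × [0,θ]` and has property (P) with `I = [θ, Mθ]`, then
`|B_{1/2} ∖ D_{Mθ}| ≤ μ |B_{1/2}|`. -/
theorem weak_harnack_inequality
    (n : ℕ) (Λ : ℝ) (hΛ : 0 < Λ) (μ : ℝ) (hμ : 0 < μ) :
    ∃ M : ℝ, 0 < M ∧
      ∀ θ : ℝ, 0 < θ →
      ∀ Γ : Set (EuclideanSpace ℝ (Fin n) × ℝ), IsClosed Γ →
        Γ ⊆ {X | ‖X.1‖ < 1} →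
        Γ ⊆ {X | 0 ≤ X.2} →
        (∃ Z ∈ Γ, ‖Z.1‖ < 1/2 ∧ Z.2 ∈ Set.Icc 0 θ) →
        PropertyP n Γ Λ (Set.Icc θ (M * θ)) →
        volume (Metric.ball (0 : EuclideanSpace ℝ (Fin n)) (1/2) \ contactProj n Γ (M * θ)) ≤
          ENNReal.ofReal μ * volume (Metric.ball (0 : EuclideanSpace ℝ (Fin n)) (1/2)) := by
  have hC := one_le_openingFactor hΛ
  set q : ℝ := 1 - ((80 * (1 + Λ)) ^ n)⁻¹ with hq
  obtain ⟨k, hk⟩ := exists_pow_lt_of_lt_one hμ (y := q) (by rw [hq]; simp; positivity)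
  refine ⟨openingFactor Λ ^ (20 + k) * 1000, by positivity, ?_⟩
  intro θ hθ Γ hΓ hcyl hpos hlow hP
  replace hcyl : ∀ X ∈ Γ, ‖X.1‖ < 1 := fun X hX => hcyl hX
  replace hpos : ∀ X ∈ Γ, 0 ≤ X.2 := fun X hX => hpos hX
  obtain ⟨Z, hZΓ, hZ, -, hZθ⟩ := hlow
  rw [mul_assoc] at hP ⊢
  have hP' : ∀ j < 20 + k, PropertyP n Γ Λ (Set.Icc (openingFactor Λ ^ j * (1000 * θ))
      (openingFactor Λ ^ (j + 1) * (1000 * θ))) := fun j hj => by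
    refine hP.mono (Icc_subset_Icc ?_ ?_)
    · have : 1 ≤ openingFactor Λ ^ j := one_le_pow₀ hC
      nlinarith
    · exact mul_le_mul_of_nonneg_right (pow_le_pow_right₀ hC (by omega)) (by positivity)
  have hnear : ∀ x ∈ ball (0 : EuclideanSpace ℝ (Fin n)) (1 / 2),
      ∃ z ∈ contactProj n Γ (openingFactor Λ ^ 20 * (1000 * θ)), ‖z - x‖ ≤ 1 / 20 := fun x hx =>
    exists_contact_near hΛ hΓ hcyl hpos (by positivity) (mem_ball_zero_iff.2 hZ) hx
      (exists_contact_near_low_point hΓ hcyl hpos hθ hZΓ hZ hZθ) fun j hj => hP' j (by omega)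
  have hdecay := volume_diff_le_geometric hΛ hΓ hcyl hpos (by positivity) k
    (fun j hj => by
      have := hP' (20 + j) (by omega)
      rwa [show 20 + j = j + 20 by ring, show j + 20 + 1 = (j + 1) + 20 by ring, pow_add, mul_assoc,
        pow_add _ (j + 1), mul_assoc] at this) hnear
  rw [← mul_assoc, ← pow_add, add_comm k] at hdecay
  have hle : volume.real (ball (0 : EuclideanSpace ℝ (Fin n)) (1 / 2) \
      contactProj n Γ (openingFactor Λ ^ (20 + k) * (1000 * θ))) ≤
      μ * volume.real (ball (0 : EuclideanSpace ℝ (Fin n)) (1 / 2)) :=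
    hdecay.trans (mul_le_mul_of_nonneg_right hk.le measureReal_nonneg)
  have hfin := (measure_ball_lt_top (μ := volume) (x := (0 : EuclideanSpace ℝ (Fin n)))
    (r := 1 / 2)).ne
  rw [← ofReal_measureReal hfin, ← ENNReal.ofReal_mul hμ.le,
    ← ofReal_measureReal (measure_ne_top_of_subset sdiff_subset hfin)]
  exact ENNReal.ofReal_le_ofReal hle

end
end

section
/- Let Γ ⊂ ℝ^{n+1} be a closed set contained in the cylinder {|x|<1}, with Γ ⊂ {x_{n+1} ≥ 0}, satisfying property (P) with constant Λ and interval I, and suppose Γ ∩ (B_{1/2}(0) × [0,θ]) ≠ ∅ for some θ > 0. Then for every a ∈ I with a ≥ θ one has 𝒟_a ⊂ {x_{n+1} ≤ 8a}; in particular, with a = Mθ, M ≥ 1, 𝒟_{Mθ} ⊂ {x_{n+1} ≤ 8Mθ}. -/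
open MeasureTheory Metric Set

noncomputable section

/-- A contact point of a paraboloid of opening `-a` is no higher than any point `X` of the set
plus `(a/2)|x-y|²`, where `y` is the center of the paraboloid. -/
theorem TangentBelow.snd_le {n : ℕ} {Γ : Set (EuclideanSpace ℝ (Fin n) × ℝ)} {a : ℝ}
    {Y Z X : EuclideanSpace ℝ (Fin n) × ℝ} (h : TangentBelow n Γ a Y Z) (ha : 0 ≤ a)
    (hX : X ∈ Γ) : Z.2 ≤ X.2 + a / 2 * ‖X.1 - Y.1‖ ^ 2 := by
  obtain ⟨-, hZ, hbelow⟩ := h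
  have hle := hbelow X hX
  have hnn : 0 ≤ a / 2 * ‖Z.1 - Y.1‖ ^ 2 := by positivity
  simp only [parab] at hZ hle
  linarith

/-- Remark 6.3: if `Γ ⊂ {x_{n+1} ≥ 0}` meets `B_{1/2} × [0,θ]`, then the
contact points of paraboloids of opening `-a`, `a ≥ θ`, satisfy `x_{n+1} ≤ 8a`; in
particular `𝒟_{Mθ} ⊂ {x_{n+1} ≤ 8Mθ}` for `M ≥ 1`. -/
theorem contact_points_height_bound
    (n : ℕ) (Λ : ℝ) (hΛ : 0 < Λ) (I : Set ℝ) (θ : ℝ) (hθ : 0 < θ)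
    (Γ : Set (EuclideanSpace ℝ (Fin n) × ℝ)) (hclosed : IsClosed Γ)
    (hcyl : Γ ⊆ {X | ‖X.1‖ < 1})
    (hpos : Γ ⊆ {X | 0 ≤ X.2})
    (hmeet : ∃ Z ∈ Γ, ‖Z.1‖ < 1/2 ∧ Z.2 ∈ Set.Icc 0 θ)
    (hP : PropertyP n Γ Λ I) :
    (∀ a ∈ I, θ ≤ a → ∀ Z ∈ contactSet n Γ a, Z.2 ≤ 8 * a) ∧
    (∀ M : ℝ, 1 ≤ M → M * θ ∈ I → ∀ Z ∈ contactSet n Γ (M * θ), Z.2 ≤ 8 * (M * θ)) := by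
  have key : ∀ a, θ ≤ a → ∀ Z ∈ contactSet n Γ a, Z.2 ≤ 8 * a := by
    rintro a ha Z ⟨-, Y, hY, hZ⟩
    obtain ⟨X, hX, hX1, -, hX2⟩ := hmeet
    have hdist : ‖X.1 - Y.1‖ ≤ 2 := by linarith [norm_sub_le X.1 Y.1]
    have hsq : ‖X.1 - Y.1‖ ^ 2 ≤ 2 ^ 2 := by gcongr
    have hle := hZ.snd_le (by linarith) hX
    nlinarith
  exact ⟨fun a _ => key a, fun M hM _ => key _ (le_mul_of_one_le_left hθ.le hM)⟩

end
end

section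
/- There exists a constant c > 0 depending only on n and Λ such that the following holds. Let θ > 0 and let Γ ⊂ ℝ^{n+1} be a closed set contained in the cylinder {|x|<1} with θ·e_{n+1} ∈ Γ ⊂ {x_{n+1} ≥ 0}, satisfying property (P) with constant Λ and I = {8θ}. Then, with a = 8θ, the projection along e_{n+1} of 𝒟_a ∩ (B_{1/2}(0) × [0, (3/2)θ]) onto ℝⁿ has Lebesgue measure at least c. -/
open MeasureTheory Metric Set

noncomputable section

/-- `Z` minimizes `X ↦ x_{n+1} + (a/2)|x-y|²` over `Γ`, i.e. the paraboloid of opening `-a` and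
center `y` through `Z` is tangent by below to `Γ` at `Z`. -/
def IsContact {n : ℕ} (Γ : Set (EuclideanSpace ℝ (Fin n) × ℝ)) (a : ℝ)
    (y : EuclideanSpace ℝ (Fin n)) (Z : EuclideanSpace ℝ (Fin n) × ℝ) : Prop :=
  Z ∈ Γ ∧ ∀ X ∈ Γ, Z.2 + a / 2 * ‖Z.1 - y‖ ^ 2 ≤ X.2 + a / 2 * ‖X.1 - y‖ ^ 2

variable {n : ℕ} {Γ : Set (EuclideanSpace ℝ (Fin n) × ℝ)} {a Λ : ℝ}

lemma IsContact.tangentBelow {y : EuclideanSpace ℝ (Fin n)} {Z : EuclideanSpace ℝ (Fin n) × ℝ}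
    (h : IsContact Γ a y Z) :
    TangentBelow n Γ a (y, Z.2 + a / 2 * ‖Z.1 - y‖ ^ 2) Z := by
  refine ⟨h.1, ?_, fun X hX => ?_⟩
  · simp only [parab]; ring
  · have := h.2 X hX
    simp only [parab]; linarith

/-- Near a contact point, the center of a touching paraboloid is given by a differentiable function
of the projected contact point, whose derivative has norm at most `1 + Λ`. -/
lemma exists_local_center_map (ha : 0 < a) (hP : PropertyP n Γ Λ {a})
    {y₀ : EuclideanSpace ℝ (Fin n)} {Z₀ : EuclideanSpace ℝ (Fin n) × ℝ}
    (h₀ : IsContact Γ a y₀ Z₀) (hy₀ : ‖y₀‖ ≤ 1) (hz₀ : ‖Z₀.1‖ ≤ 3 / 4) :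
    ∃ (g : EuclideanSpace ℝ (Fin n) → EuclideanSpace ℝ (Fin n))
      (L : EuclideanSpace ℝ (Fin n) →L[ℝ] EuclideanSpace ℝ (Fin n)),
      ‖L‖ ≤ 1 + Λ ∧ HasFDerivAt g L Z₀.1 ∧
      ∀ᶠ z in nhds Z₀.1, ∀ y h, IsContact Γ a y (z, h) → y = g z := by
  obtain ⟨r, hr, v, hv, hD, hG⟩ := hP a (mem_singleton a)
    (y₀, Z₀.2 + a / 2 * ‖Z₀.1 - y₀‖ ^ 2) Z₀ hy₀ hz₀ h₀.tangentBelow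
  let T : StrongDual ℝ (EuclideanSpace ℝ (Fin n)) →ₗᵢ[ℝ] EuclideanSpace ℝ (Fin n) :=
    { toFun := (InnerProductSpace.toDual ℝ (EuclideanSpace ℝ (Fin n))).symm
      map_add' := fun x y => by simp
      map_smul' := fun c x => by simp
      norm_map' := fun x => by simp }
  have hT : ∀ ℓ x, inner ℝ (T ℓ) x = ℓ x := fun ℓ x => by
    change inner ℝ ((InnerProductSpace.toDual ℝ (EuclideanSpace ℝ (Fin n))).symm ℓ) x = ℓ x
    simp
  have hvd : Differentiable ℝ v := hv.differentiable (by norm_num)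
  have hv2 : DifferentiableAt ℝ (fderiv ℝ v) Z₀.1 :=
    ((hv.fderiv_right (m := 1) (by norm_num)).differentiable (by norm_num)) _
  have hD' : ‖fderiv ℝ (fderiv ℝ v) Z₀.1‖ ≤ Λ * a := by
    rwa [← norm_iteratedFDeriv_one, norm_iteratedFDeriv_fderiv]
  have hmem : ∀ X ∈ ball Z₀ r, (X ∈ Γ ↔ X.2 = v X.1) := fun X hX => by
    have := Set.ext_iff.1 hG X
    simpa [hX] using this
  have hvz : Z₀.2 = v Z₀.1 := (hmem Z₀ (mem_ball_self hr)).1 h₀.1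
  refine ⟨fun z => z + a⁻¹ • T (fderiv ℝ v z),
    ContinuousLinearMap.id ℝ _ +
      a⁻¹ • (T.toContinuousLinearMap ∘L fderiv ℝ (fderiv ℝ v) Z₀.1), ?_, ?_, ?_⟩
  · refine (norm_add_le _ _).trans (add_le_add ContinuousLinearMap.norm_id_le ?_)
    rw [norm_smul, Real.norm_of_nonneg (inv_nonneg.2 ha.le), T.norm_toContinuousLinearMap_comp,
      inv_mul_le_iff₀ ha]
    linarith
  · have hTv : HasFDerivAt (fun z => T.toContinuousLinearMap (fderiv ℝ v z))
        (T.toContinuousLinearMap ∘L fderiv ℝ (fderiv ℝ v) Z₀.1) Z₀.1 :=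
      T.toContinuousLinearMap.hasFDerivAt.comp Z₀.1 hv2.hasFDerivAt
    exact (hasFDerivAt_id Z₀.1).add (hTv.const_smul a⁻¹)
  · have e1 : ∀ᶠ z in nhds Z₀.1, (z, v z) ∈ ball Z₀ r := by
      have : Filter.Tendsto (fun z => (z, v z)) (nhds Z₀.1) (nhds Z₀) := by
        have := (continuous_id.prodMk hv.continuous).tendsto Z₀.1
        simpa [← hvz] using this
      exact this (ball_mem_nhds _ hr)
    have e2 : ∀ᶠ z in nhds Z₀.1,
        Z₀.2 - r < Z₀.2 + a / 2 * ‖Z₀.1 - y₀‖ ^ 2 - a / 2 * ‖z - y₀‖ ^ 2 := by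
      have : ContinuousAt (fun z : EuclideanSpace ℝ (Fin n) =>
        Z₀.2 + a / 2 * ‖Z₀.1 - y₀‖ ^ 2 - a / 2 * ‖z - y₀‖ ^ 2) Z₀.1 := by fun_prop
      exact this.eventually (lt_mem_nhds (by simp; linarith))
    filter_upwards [e1, e2, eventually_eventually_nhds.2 e1] with z hz1 hz2 hz3 y h hc
    have hin : (z, v z) ∈ Γ := (hmem _ hz1).2 rfl
    have hle : h ≤ v z := by
      have := hc.2 _ hin
      simp only at this
      linarith
    have hge := h₀.2 _ hc.1
    simp only at hge
    have hb : (z, h) ∈ ball Z₀ r := by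
      rw [mem_ball, Prod.dist_eq, max_lt_iff] at hz1 ⊢
      refine ⟨hz1.1, ?_⟩
      have := hz1.2
      simp only [Real.dist_eq, abs_lt] at this ⊢
      constructor <;> linarith
    have hhv : h = v z := (hmem _ hb).1 hc.1
    have hmin : IsLocalMin (fun x => v x + a / 2 * ‖x - y‖ ^ 2) z := by
      filter_upwards [hz3] with x hx
      have := hc.2 _ ((hmem _ hx).2 rfl)
      simpa [hhv] using this
    have hder : HasFDerivAt (fun x => v x + a / 2 * ‖x - y‖ ^ 2)
        (fderiv ℝ v z + (a / 2) • (2 • (innerSL ℝ (z - y)).comp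
          (ContinuousLinearMap.id ℝ (EuclideanSpace ℝ (Fin n))))) z := by
      refine (hvd z).hasFDerivAt.add ?_
      exact (((hasFDerivAt_id z).sub_const y).norm_sq).const_mul (a / 2)
    have h0 := hmin.hasFDerivAt_eq_zero hder
    refine ext_inner_right ℝ fun x => ?_
    have hx := DFunLike.congr_fun h0 x
    simp at hx
    rw [inner_add_left, inner_smul_left, hT]
    simp only [conj_trivial]
    field_simp
    linarith

lemma abs_det_le_norm_pow (L : EuclideanSpace ℝ (Fin n) →L[ℝ] EuclideanSpace ℝ (Fin n)) :
    |L.det| ≤ ‖L‖ ^ n := by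
  have h1 := Measure.addHaar_image_continuousLinearMap volume L (closedBall 0 1)
  have h2 : L '' closedBall 0 1 ⊆ closedBall 0 (‖L‖ * 1) := by
    rintro _ ⟨x, hx, rfl⟩
    rw [mem_closedBall_zero_iff] at hx ⊢
    exact L.le_of_opNorm_le_of_le le_rfl hx
  have h3 := measure_mono (μ := volume) h2
  rw [h1, Measure.addHaar_closedBall_mul _ _ (norm_nonneg _) zero_le_one,
    finrank_euclideanSpace_fin] at h3
  have h4 : volume (closedBall (0 : EuclideanSpace ℝ (Fin n)) 1) ≠ 0 :=
    (measure_closedBall_pos _ _ one_pos).ne'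
  have h5 : volume (closedBall (0 : EuclideanSpace ℝ (Fin n)) 1) ≠ ⊤ :=
    measure_closedBall_lt_top.ne
  rw [ENNReal.mul_le_mul_iff_left h4 h5] at h3
  exact (ENNReal.ofReal_le_ofReal_iff (by positivity)).1 h3

lemma isCompact_setOf_isContact (hΓ : IsClosed Γ) (h1 : ∀ X ∈ Γ, ‖X.1‖ < 1)
    (h2 : ∀ X ∈ Γ, 0 ≤ X.2) (ha : 0 < a) (hne : Γ.Nonempty)
    {K : Set (EuclideanSpace ℝ (Fin n))} (hK : IsCompact K) :
    IsCompact {p : EuclideanSpace ℝ (Fin n) × EuclideanSpace ℝ (Fin n) × ℝ |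
      p.1 ∈ K ∧ IsContact Γ a p.1 p.2} := by
  obtain ⟨X₀, hX₀⟩ := hne
  obtain ⟨M, hM⟩ := (hK.image (f := fun y => X₀.2 + a / 2 * ‖X₀.1 - y‖ ^ 2)
    (by fun_prop)).bddAbove
  refine (hK.prod ((isCompact_closedBall (0 : EuclideanSpace ℝ (Fin n)) 1).prod
    (isCompact_Icc (a := (0 : ℝ)) (b := M)))).of_isClosed_subset ?_ ?_
  · have : {p : EuclideanSpace ℝ (Fin n) × EuclideanSpace ℝ (Fin n) × ℝ |
        p.1 ∈ K ∧ IsContact Γ a p.1 p.2} = (Prod.fst ⁻¹' K) ∩ ((Prod.snd ⁻¹' Γ) ∩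
        ⋂ X ∈ Γ, {p | p.2.2 + a / 2 * ‖p.2.1 - p.1‖ ^ 2 ≤ X.2 + a / 2 * ‖X.1 - p.1‖ ^ 2}) := by
      ext p; simp [IsContact]
    rw [this]
    refine (hK.isClosed.preimage continuous_fst).inter
      ((hΓ.preimage continuous_snd).inter (isClosed_biInter fun X _ => ?_))
    exact isClosed_le (by fun_prop) (by fun_prop)
  · rintro ⟨y, z, h⟩ ⟨hy, hc⟩
    refine ⟨hy, by simpa using (h1 _ hc.1).le, h2 _ hc.1, ?_⟩
    have e1 := hc.2 _ hX₀
    have e2 := hM (mem_image_of_mem _ hy)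
    have : 0 ≤ a / 2 * ‖z - y‖ ^ 2 := by positivity
    simp only at e1 e2 ⊢
    linarith

lemma exists_isContact (hΓ : IsClosed Γ) (h1 : ∀ X ∈ Γ, ‖X.1‖ < 1)
    (h2 : ∀ X ∈ Γ, 0 ≤ X.2) (ha : 0 < a) (hne : Γ.Nonempty) (y : EuclideanSpace ℝ (Fin n)) :
    ∃ Z, IsContact Γ a y Z := by
  obtain ⟨X₀, hX₀⟩ := hne
  set M := X₀.2 + a / 2 * ‖X₀.1 - y‖ ^ 2 with hM
  have hnn : ∀ x : EuclideanSpace ℝ (Fin n), 0 ≤ a / 2 * ‖x - y‖ ^ 2 := fun x => by positivity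
  have hS : IsCompact (((closedBall (0 : EuclideanSpace ℝ (Fin n)) 1) ×ˢ Icc 0 M) ∩ Γ) :=
    ((isCompact_closedBall _ _).prod isCompact_Icc).inter_right hΓ
  obtain ⟨Z, hZ, hmin⟩ := hS.exists_isMinOn
    (f := fun X : EuclideanSpace ℝ (Fin n) × ℝ => X.2 + a / 2 * ‖X.1 - y‖ ^ 2)
    ⟨X₀, ⟨by simpa using (h1 _ hX₀).le, h2 _ hX₀, by have := hnn X₀.1; linarith⟩, hX₀⟩
    (by fun_prop)
  have hX₀mem : X₀ ∈ ((closedBall (0 : EuclideanSpace ℝ (Fin n)) 1) ×ˢ Icc 0 M) ∩ Γ :=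
    ⟨⟨by simpa using (h1 _ hX₀).le, h2 _ hX₀, by have := hnn X₀.1; linarith⟩, hX₀⟩
  refine ⟨Z, hZ.2, fun X hX => ?_⟩
  by_cases hXM : X.2 ≤ M
  · exact hmin (show X ∈ _ from ⟨⟨by simpa using (h1 _ hX).le, h2 _ hX, hXM⟩, hX⟩)
  · have e1 : Z.2 + a / 2 * ‖Z.1 - y‖ ^ 2 ≤ M := hmin hX₀mem
    have := hnn X.1
    push Not at hXM
    linarith

/-- The measure of a compact set of centers is controlled by that of the contact points. -/
lemma volume_centers_le_s16 (hΓ : IsClosed Γ) (h1 : ∀ X ∈ Γ, ‖X.1‖ < 1)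
    (h2 : ∀ X ∈ Γ, 0 ≤ X.2) (ha : 0 < a) (hne : Γ.Nonempty) (hP : PropertyP n Γ Λ {a})
    {K : Set (EuclideanSpace ℝ (Fin n))} (hK : IsCompact K) (hK1 : ∀ y ∈ K, ‖y‖ ≤ 1)
    (hK2 : ∀ y ∈ K, ∀ Z, IsContact Γ a y Z → ‖Z.1‖ ≤ 3 / 4) :
    volume K ≤ ENNReal.ofReal ((1 + Λ) ^ n) *
      volume {z | ∃ y ∈ K, ∃ h, IsContact Γ a y (z, h)} := by
  set A := {z | ∃ y ∈ K, ∃ h, IsContact Γ a y (z, h)} with hA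
  have hAm : MeasurableSet A := by
    have hc := (isCompact_setOf_isContact hΓ h1 h2 ha hne hK).image
      (f := fun p => p.2.1) (by fun_prop)
    convert hc.measurableSet using 1
    ext z
    constructor
    · rintro ⟨y, hy, h, hc⟩
      exact ⟨(y, z, h), ⟨hy, hc⟩, rfl⟩
    · rintro ⟨⟨y, z, h⟩, ⟨hy, hc⟩, rfl⟩
      exact ⟨y, hy, h, hc⟩
  have key : ∀ z, ∃ y : EuclideanSpace ℝ (Fin n), z ∈ A → y ∈ K ∧ ∃ h, IsContact Γ a y (z, h) := by
    intro z
    by_cases hz : z ∈ A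
    · obtain ⟨y, hy⟩ := hz
      exact ⟨y, fun _ => hy⟩
    · exact ⟨0, fun h => absurd h hz⟩
  choose f hf using key
  have key2 : ∀ z, ∃ (g : EuclideanSpace ℝ (Fin n) → EuclideanSpace ℝ (Fin n))
      (L : EuclideanSpace ℝ (Fin n) →L[ℝ] EuclideanSpace ℝ (Fin n)), z ∈ A →
      ‖L‖ ≤ 1 + Λ ∧ HasFDerivAt g L z ∧
      ∀ᶠ z in nhds z, ∀ y h, IsContact Γ a y (z, h) → y = g z := by
    intro z
    by_cases hz : z ∈ A
    · obtain ⟨hy, h, hc⟩ := hf z hz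
      obtain ⟨g, L, H⟩ := exists_local_center_map ha hP hc (hK1 _ hy) (hK2 _ hy _ hc)
      exact ⟨g, L, fun _ => H⟩
    · exact ⟨id, 0, fun h => absurd h hz⟩
  choose g L hgL using key2
  have hder : ∀ z ∈ A, HasFDerivWithinAt f (L z) A z := by
    intro z hz
    obtain ⟨-, hd, hev⟩ := hgL z hz
    refine hd.hasFDerivWithinAt.congr_of_eventuallyEq ?_ ?_
    · filter_upwards [nhdsWithin_le_nhds hev, self_mem_nhdsWithin] with x hx hxA
      obtain ⟨-, h, hc⟩ := hf x hxA
      exact hx _ _ hc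
    · obtain ⟨-, h, hc⟩ := hf z hz
      exact hev.self_of_nhds _ _ hc
  have hsub : K ⊆ f '' A := by
    intro y hy
    obtain ⟨⟨z, h⟩, hc⟩ := exists_isContact hΓ h1 h2 ha hne y
    have hz : z ∈ A := ⟨y, hy, h, hc⟩
    refine ⟨z, hz, ?_⟩
    obtain ⟨-, h', hc'⟩ := hf z hz
    have hev := (hgL z hz).2.2.self_of_nhds
    rw [hev _ _ hc', hev _ _ hc]
  calc volume K ≤ volume (f '' A) := measure_mono hsub
    _ ≤ ∫⁻ z in A, ENNReal.ofReal |(L z).det| :=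
      addHaar_image_le_lintegral_abs_det_fderiv volume hAm hder
    _ ≤ ∫⁻ _ in A, ENNReal.ofReal ((1 + Λ) ^ n) := by
      refine setLIntegral_mono measurable_const fun z hz => ENNReal.ofReal_le_ofReal ?_
      exact (abs_det_le_norm_pow _).trans (pow_le_pow_left₀ (norm_nonneg _) (hgL z hz).1 n)
    _ = _ := by simp

/-- A thin slab inside a ball has small measure. -/
lemma volume_slab_le {ρ : ℝ} (hρ : 0 < ρ) (hρ1 : ρ ≤ 1) {w : EuclideanSpace ℝ (Fin n)}
    (hw : 1 / 4 ≤ ‖w‖) (z₀ : EuclideanSpace ℝ (Fin n)) :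
    volume {z | ‖z - z₀‖ ≤ 5 * ρ ∧ |inner ℝ w (z - z₀)| ≤ 12 * ρ ^ 2} ≤
      ENNReal.ofReal (ρ * 53 ^ n) * volume (closedBall (0 : EuclideanSpace ℝ (Fin n)) ρ) := by
  set S := {z | ‖z‖ ≤ 5 * ρ ∧ |inner ℝ w z| ≤ 12 * ρ ^ 2} with hS
  have hS0 : {z | ‖z - z₀‖ ≤ 5 * ρ ∧ |inner ℝ w (z - z₀)| ≤ 12 * ρ ^ 2} =
      (fun z => z + -z₀) ⁻¹' S := by
    ext z; simp [hS, sub_eq_add_neg]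
  rw [hS0, measure_preimage_add_right]
  have hw0 : 0 < ‖w‖ := by linarith
  set T := LinearMap.transvection (innerₛₗ ℝ w) (((ρ⁻¹ - 1) / ‖w‖ ^ 2) • w) with hT
  have hdet : LinearMap.det T = ρ⁻¹ := by
    rw [hT, LinearMap.transvection.det]
    simp only [innerₛₗ_apply_apply, inner_smul_right, real_inner_self_eq_norm_sq]
    field_simp
    ring
  have hsub : T '' S ⊆ closedBall 0 (53 * ρ) := by
    rintro _ ⟨u, ⟨hu1, hu2⟩, rfl⟩
    rw [mem_closedBall_zero_iff, hT, LinearMap.transvection.apply]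
    have hc : 0 ≤ ρ⁻¹ - 1 := sub_nonneg.2 ((one_le_inv₀ hρ).2 hρ1)
    have e : ‖(innerₛₗ ℝ w) u • ((ρ⁻¹ - 1) / ‖w‖ ^ 2) • w‖ ≤ 48 * ρ := by
      rw [norm_smul, norm_smul, innerₛₗ_apply_apply, Real.norm_eq_abs,
        Real.norm_of_nonneg (by positivity)]
      have e1 : (ρ⁻¹ - 1) / ‖w‖ ^ 2 * ‖w‖ ≤ 4 * ρ⁻¹ := by
        have : (ρ⁻¹ - 1) / ‖w‖ ^ 2 * ‖w‖ = (ρ⁻¹ - 1) / ‖w‖ := by field_simp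
        rw [this, div_le_iff₀ hw0]
        have : 0 < ρ⁻¹ := inv_pos.2 hρ
        nlinarith
      calc |inner ℝ w u| * ((ρ⁻¹ - 1) / ‖w‖ ^ 2 * ‖w‖) ≤ (12 * ρ ^ 2) * (4 * ρ⁻¹) := by
            gcongr
        _ = 48 * ρ := by field_simp; ring
    linarith [norm_add_le u ((innerₛₗ ℝ w) u • ((ρ⁻¹ - 1) / ‖w‖ ^ 2) • w)]
  have h3 := measure_mono (μ := volume) hsub
  rw [Measure.addHaar_image_linearMap, hdet,
    Measure.addHaar_closedBall_mul _ _ (by norm_num) hρ.le, finrank_euclideanSpace_fin,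
    abs_of_pos (inv_pos.2 hρ)] at h3
  calc volume S = ENNReal.ofReal ρ * (ENNReal.ofReal ρ⁻¹ * volume S) := by
        rw [← mul_assoc, ← ENNReal.ofReal_mul hρ.le, mul_inv_cancel₀ hρ.ne']; simp
    _ ≤ ENNReal.ofReal ρ * (ENNReal.ofReal (53 ^ n) *
        volume (closedBall (0 : EuclideanSpace ℝ (Fin n)) ρ)) := by gcongr
    _ = _ := by rw [ENNReal.ofReal_mul hρ.le, mul_assoc]

/-- Contact points of two paraboloids depend monotonically on the centers. -/
lemma IsContact.inner_nonneg (ha : 0 < a) {y y₀ : EuclideanSpace ℝ (Fin n)}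
    {Z Z₀ : EuclideanSpace ℝ (Fin n) × ℝ} (h : IsContact Γ a y Z) (h₀ : IsContact Γ a y₀ Z₀) :
    0 ≤ inner ℝ (y - y₀) (Z.1 - Z₀.1) := by
  have e1 := h.2 _ h₀.1
  have e2 := h₀.2 _ h.1
  simp only [← real_inner_self_eq_norm_sq, inner_sub_left, inner_sub_right] at e1 e2 ⊢
  simp only [real_inner_comm y Z.1, real_inner_comm y Z₀.1, real_inner_comm y₀ Z.1,
    real_inner_comm y₀ Z₀.1] at e1 e2 ⊢
  by_contra! hneg
  nlinarith [mul_neg_of_pos_of_neg ha hneg]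

/-- If a paraboloid centered near the origin touches outside `B_{1/2}`, all paraboloids with
centers near the midpoint of center and contact point touch in a thin slab. -/
lemma IsContact.mem_slab {θ ρ : ℝ} (hθ : 0 < θ) (hρ : 0 < ρ)
    (h2 : ∀ X ∈ Γ, 0 ≤ X.2) {y₀ η : EuclideanSpace ℝ (Fin n)}
    {Z Z₀ : EuclideanSpace ℝ (Fin n) × ℝ} (h₀ : IsContact Γ (8 * θ) y₀ Z₀)
    (hZ₀ : Z₀.2 ≤ 8 * ρ ^ 2 * θ) (hη : ‖η‖ ≤ ρ)
    (h : IsContact Γ (8 * θ) (y₀ + (1 / 2 : ℝ) • (Z₀.1 - y₀) + η) Z) :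
    ‖Z.1 - Z₀.1‖ ≤ 5 * ρ ∧ |inner ℝ (Z₀.1 - y₀) (Z.1 - Z₀.1)| ≤ 12 * ρ ^ 2 := by
  set w := Z₀.1 - y₀ with hw
  set u := Z.1 - Z₀.1 with hu
  have m := h.inner_nonneg (by positivity) h₀
  have e := h.2 _ h₀.1
  have hz := h2 _ h.1
  have a1 : Z.1 - (y₀ + (1 / 2 : ℝ) • w + η) = u + ((1 / 2 : ℝ) • w - η) := by
    rw [hu, hw]; module
  have a2 : Z₀.1 - (y₀ + (1 / 2 : ℝ) • w + η) = (1 / 2 : ℝ) • w - η := by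
    rw [hw]; module
  have a3 : y₀ + (1 / 2 : ℝ) • w + η - y₀ = (1 / 2 : ℝ) • w + η := by module
  rw [a1, a2, norm_add_sq_real, inner_sub_right, inner_smul_right, real_inner_comm w u] at e
  rw [a3, ← hu, inner_add_left, inner_smul_left] at m
  simp only [conj_trivial] at m
  have hc : |inner ℝ η u| ≤ ρ * ‖u‖ :=
    (abs_real_inner_le_norm _ _).trans (by gcongr)
  rw [real_inner_comm η u] at e
  obtain ⟨hc1, hc2⟩ := abs_le.1 hc
  have hup : inner ℝ w u - 2 * inner ℝ η u + ‖u‖ ^ 2 ≤ 2 * ρ ^ 2 := by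
    nlinarith
  have hu5 : ‖u‖ ≤ 5 * ρ := by
    by_contra! hlt
    nlinarith [norm_nonneg u]
  refine ⟨hu5, abs_le.2 ⟨?_, ?_⟩⟩ <;> nlinarith [sq_nonneg ‖u‖]

/-- Paraboloids with opening `-8θ` centered close enough to the origin touch in `B_{1/2}`. -/
lemma IsContact.norm_lt_half (hΛ : 0 < Λ) {θ ρ : ℝ} (hθ : 0 < θ) (hρ : 0 < ρ)
    (hρ1 : ρ ≤ 1 / 100) (hρΛ : (1 + Λ) ^ n * (ρ * 53 ^ n) < 1) (hΓ : IsClosed Γ)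
    (h1 : ∀ X ∈ Γ, ‖X.1‖ < 1) (h2 : ∀ X ∈ Γ, 0 ≤ X.2) (h0 : (0, θ) ∈ Γ)
    (hP : PropertyP n Γ Λ {8 * θ}) {y₀ : EuclideanSpace ℝ (Fin n)} (hy₀ : ‖y₀‖ ≤ ρ ^ 2)
    {Z₀ : EuclideanSpace ℝ (Fin n) × ℝ} (h₀ : IsContact Γ (8 * θ) y₀ Z₀) : ‖Z₀.1‖ < 1 / 2 := by
  by_contra! hz
  have hz1 := h1 _ h₀.1
  have hZnn := h2 _ h₀.1
  have hin : |inner ℝ Z₀.1 y₀| ≤ ρ ^ 2 :=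
    (abs_real_inner_le_norm _ _).trans (by nlinarith [norm_nonneg y₀, norm_nonneg Z₀.1])
  have e := h₀.2 _ h0
  simp only [zero_sub, norm_neg] at e
  rw [norm_sub_sq_real] at e
  have hin2 := (abs_le.1 hin).2
  have hup : Z₀.2 ≤ θ * (1 - 4 * ‖Z₀.1‖ ^ 2 + 8 * ρ ^ 2) := by nlinarith
  have hsq : 1 ≤ 4 * ‖Z₀.1‖ ^ 2 := by nlinarith
  have hZ₀ : Z₀.2 ≤ 8 * ρ ^ 2 * θ := by nlinarith
  have hz2 : 4 * ‖Z₀.1‖ ^ 2 ≤ 1 + 8 * ρ ^ 2 := by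
    by_contra! hlt
    nlinarith
  have hρ2 : ρ ^ 2 ≤ 1 / 10000 := by nlinarith
  have hz3 : ‖Z₀.1‖ ≤ 51 / 100 := by nlinarith
  set w := Z₀.1 - y₀ with hw
  have hw1 : 1 / 4 ≤ ‖w‖ := by linarith [norm_sub_norm_le Z₀.1 y₀]
  have hw2 : ‖w‖ ≤ 52 / 100 := by linarith [norm_sub_le Z₀.1 y₀]
  set y₁ := y₀ + (1 / 2 : ℝ) • w with hy₁
  have hslab : ∀ y ∈ closedBall y₁ ρ, ∀ Z, IsContact Γ (8 * θ) y Z →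
      ‖Z.1 - Z₀.1‖ ≤ 5 * ρ ∧ |inner ℝ w (Z.1 - Z₀.1)| ≤ 12 * ρ ^ 2 := by
    intro y hy Z hZ
    refine h₀.mem_slab hθ hρ h2 hZ₀ (η := y - y₁) (by simpa [dist_eq_norm] using hy) ?_
    rwa [← hw, ← hy₁, add_sub_cancel]
  have hy₁n : ‖y₁‖ ≤ 1 / 2 := by
    have := norm_add_le y₀ ((1 / 2 : ℝ) • w)
    rw [norm_smul] at this
    norm_num at this
    linarith
  have hvol := volume_centers_le_s16 hΓ h1 h2 (by positivity) ⟨_, h0⟩ hP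
    (isCompact_closedBall y₁ ρ) (fun y hy => by
      have h3 : ‖y - y₁‖ ≤ ρ := by simpa [dist_eq_norm] using hy
      linarith [norm_le_norm_add_norm_sub' y y₁]) (fun y hy Z hZ => by
      have h3 := (hslab y hy Z hZ).1
      linarith [norm_le_norm_add_norm_sub' Z.1 Z₀.1])
  have hle : volume {z | ∃ y ∈ closedBall y₁ ρ, ∃ h, IsContact Γ (8 * θ) y (z, h)} ≤
      ENNReal.ofReal (ρ * 53 ^ n) * volume (closedBall (0 : EuclideanSpace ℝ (Fin n)) ρ) := by
    refine (measure_mono ?_).trans (volume_slab_le hρ (by linarith) hw1 Z₀.1)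
    rintro z ⟨y, hy, h, hc⟩
    exact hslab y hy (z, h) hc
  have hfin := hvol.trans (mul_le_mul_right hle _)
  rw [Measure.addHaar_closedBall_center, ← mul_assoc, ← ENNReal.ofReal_mul (by positivity)] at hfin
  have h4 : volume (closedBall (0 : EuclideanSpace ℝ (Fin n)) ρ) ≠ 0 :=
    (measure_closedBall_pos _ _ hρ).ne'
  have h5 : volume (closedBall (0 : EuclideanSpace ℝ (Fin n)) ρ) ≠ ⊤ :=
    measure_closedBall_lt_top.ne
  refine hfin.not_gt ?_
  calc _ < 1 * volume (closedBall (0 : EuclideanSpace ℝ (Fin n)) ρ) := by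
        refine (ENNReal.mul_lt_mul_iff_left h4 h5).2 ?_
        rwa [← ENNReal.ofReal_one, ENNReal.ofReal_lt_ofReal_iff one_pos]
    _ = _ := one_mul _

/-- Proposition 6.4, estimate in measure: if `θ e_{n+1} ∈ Γ ⊂ {x_{n+1} ≥ 0}`
and `Γ` has property (P) with `a = 8θ`, then `𝒟_a ∩ (B_{1/2} × [0, (3/2)θ])` projects along
`e_{n+1}` onto a set of measure at least `c > 0` universal. -/
theorem estimate_in_measure
    (n : ℕ) (Λ : ℝ) (hΛ : 0 < Λ) :
    ∃ c : ℝ, 0 < c ∧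
      ∀ θ : ℝ, 0 < θ →
      ∀ Γ : Set (EuclideanSpace ℝ (Fin n) × ℝ), IsClosed Γ →
        Γ ⊆ {X | ‖X.1‖ < 1} →
        Γ ⊆ {X | 0 ≤ X.2} →
        ((0 : EuclideanSpace ℝ (Fin n)), θ) ∈ Γ →
        PropertyP n Γ Λ {8 * θ} →
        ENNReal.ofReal c ≤
          volume (Prod.fst '' (contactSet n Γ (8 * θ) ∩
            {Z : EuclideanSpace ℝ (Fin n) × ℝ | ‖Z.1‖ < 1/2 ∧
              Z.2 ∈ Set.Icc 0 ((3/2) * θ)})) := by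
  set q := ((1 + Λ) * 53) ^ n with hq
  have hq1 : 1 ≤ q := one_le_pow₀ (by nlinarith)
  set ρ := 1 / (100 * q) with hρ
  have hρ0 : 0 < ρ := by positivity
  have hρ1 : ρ ≤ 1 / 100 := by
    rw [hρ]
    exact one_div_le_one_div_of_le (by norm_num) (by linarith)
  have hρΛ : (1 + Λ) ^ n * (ρ * 53 ^ n) < 1 := by
    have : (1 + Λ) ^ n * (ρ * 53 ^ n) = ρ * q := by rw [hq, mul_pow]; ring
    rw [this, hρ]
    field_simp
    norm_num
  set V := volume (closedBall (0 : EuclideanSpace ℝ (Fin n)) (ρ ^ 2)) with hV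
  have hV0 : V ≠ 0 := (measure_closedBall_pos _ _ (by positivity)).ne'
  have hVt : V ≠ ⊤ := measure_closedBall_lt_top.ne
  have hΛn : 0 < (1 + Λ) ^ n := by positivity
  refine ⟨V.toReal / (1 + Λ) ^ n, div_pos (ENNReal.toReal_pos hV0 hVt) hΛn, ?_⟩
  intro θ hθ Γ hΓ h1 h2 h0 hP
  have hhalf : ∀ y ∈ closedBall (0 : EuclideanSpace ℝ (Fin n)) (ρ ^ 2), ∀ Z,
      IsContact Γ (8 * θ) y Z → ‖Z.1‖ < 1 / 2 := fun y hy Z hZ =>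
    hZ.norm_lt_half hΛ hθ hρ0 hρ1 hρΛ hΓ h1 h2 h0 hP (by simpa using hy)
  have hρ2 : ρ ^ 2 ≤ 1 / 10000 := by nlinarith
  have hy1 : ∀ y ∈ closedBall (0 : EuclideanSpace ℝ (Fin n)) (ρ ^ 2), ‖y‖ ≤ 1 / 10000 :=
    fun y hy => (mem_closedBall_zero_iff.1 hy).trans hρ2
  have hvol := volume_centers_le_s16 hΓ h1 h2 (by positivity) ⟨_, h0⟩ hP
    (isCompact_closedBall (0 : EuclideanSpace ℝ (Fin n)) (ρ ^ 2))
    (fun y hy => by linarith [hy1 y hy])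
    (fun y hy Z hZ => by linarith [hhalf y hy Z hZ])
  rw [ENNReal.ofReal_div_of_pos hΛn, ENNReal.ofReal_toReal hVt]
  refine ENNReal.div_le_of_le_mul' (hvol.trans (mul_le_mul_right (measure_mono ?_) _))
  rintro z ⟨y, hy, h, hc⟩
  have hz := hhalf y hy _ hc
  have hyn := hy1 y hy
  refine ⟨(z, h), ⟨⟨by linarith, _, by simp only; linarith, hc.tangentBelow⟩, hz, h2 hc.1, ?_⟩, rfl⟩
  have e := hc.2 _ h0
  simp only [zero_sub, norm_neg] at e ⊢
  have : 0 ≤ θ * ‖z - y‖ ^ 2 := by positivity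
  have : ‖y‖ ^ 2 ≤ 1 / 8 := by nlinarith [norm_nonneg y]
  nlinarith

end
end
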